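/- arXiv:2306.11564 — 11 statements merged into one kernel-verified Lean document; each statement's English description precedes it below -/
import Mathlib

section
/- If a numerical semigroup S is a k-quotient, i.e., S = ⟨a₁,…,a_k⟩/d for some positive integers d, a₁,…,a_k, then S is k-ray-normalescent: there exist m ≥ 1, a rational polyhedral cone C ⊆ ℝ^m generated by k integer vectors (hence having at most k extreme rays), and a linear map π : ℝ^m → ℝ with integer coefficients satisfying π(C) ⊆ ℝ_{≥0}, such that S = π(C ∩ ℤ^m). -/
open scoped BigOperators

/-- The cone generated by the vectors `v i` in `ℝ^m`: all nonnegative real combinations. -/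
def coneGen {m l : ℕ} (v : Fin l → (Fin m → ℝ)) : Set (Fin m → ℝ) :=
  {x | ∃ c : Fin l → ℝ, (∀ i, 0 ≤ c i) ∧ x = ∑ i, c i • v i}

/-- Coercion of an integer vector to a real vector. -/
def toReal {m : ℕ} (z : Fin m → ℤ) : Fin m → ℝ := fun i => (z i : ℝ)

/-- A numerical semigroup: contains 0 and is closed under addition. -/
def IsNumericalSemigroup (S : Set ℕ) : Prop :=
  0 ∈ S ∧ ∀ a ∈ S, ∀ b ∈ S, a + b ∈ S

/-- The numerical semigroup `⟨a 1, …, a n⟩` generated by the `a i`. -/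
def numGen {n : ℕ} (a : Fin n → ℕ) : Set ℕ :=
  {t | ∃ x : Fin n → ℕ, t = ∑ i, a i * x i}

/-- The quotient `T/d = {t ∈ ℕ : d t ∈ T}`. -/
def numQuot (T : Set ℕ) (d : ℕ) : Set ℕ := {t | d * t ∈ T}

/-- `S` is a `k`-quotient: `S = ⟨a 1, …, a k⟩ / d` for positive integers `d, a i`. -/
def IsKQuotient (k : ℕ) (S : Set ℕ) : Prop :=
  ∃ (d : ℕ) (a : Fin k → ℕ), 0 < d ∧ (∀ i, 0 < a i) ∧ S = numQuot (numGen a) d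

/-- `S` is `k`-ray-normalescent: `S = π(C ∩ ℤ^m)` where `C ⊆ ℝ^m` is a rational polyhedral
cone generated by `k` integer vectors (so with at most `k` extreme rays) and `π` is a linear
functional with integer coefficients `p` satisfying `π(C) ⊆ ℝ≥0`. -/
def IsKRayNormalescent (k : ℕ) (S : Set ℕ) : Prop :=
  ∃ (m : ℕ) (v : Fin k → (Fin m → ℤ)) (p : Fin m → ℤ),
    (∀ x ∈ coneGen (fun i => toReal (v i)), 0 ≤ ∑ j, (p j : ℝ) * x j) ∧
    {t : ℤ | ∃ z : Fin m → ℤ, toReal z ∈ coneGen (fun i => toReal (v i)) ∧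
        t = ∑ j, p j * z j} = (fun n : ℕ => (n : ℤ)) '' S

/-- `S` is `k`-normalescent: `S = π(C ∩ ℤ^m)` where `C ⊆ ℝ^m` is a `k`-dimensional rational
polyhedral cone and `π` is a linear functional with integer coefficients `p` with
`π(C) ⊆ ℝ≥0`. -/
def IsKNormalescent (k : ℕ) (S : Set ℕ) : Prop :=
  ∃ (m l : ℕ) (v : Fin l → (Fin m → ℤ)) (p : Fin m → ℤ),
    Module.finrank ℝ (Submodule.span ℝ (Set.range (fun i => toReal (v i)))) = k ∧
    (∀ x ∈ coneGen (fun i => toReal (v i)), 0 ≤ ∑ j, (p j : ℝ) * x j) ∧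
    {t : ℤ | ∃ z : Fin m → ℤ, toReal z ∈ coneGen (fun i => toReal (v i)) ∧
        t = ∑ j, p j * z j} = (fun n : ℕ => (n : ℤ)) '' S

/-- The cone generated by the vectors `(a i, d • e i)` is the simplicial cone
`{(t, x) | d * t = ∑ i, a i * x i, 0 ≤ x}`. -/
theorem mem_coneGen_cons_single {k d : ℕ} (hd : 0 < d) (a : Fin k → ℕ) (x : Fin (k + 1) → ℝ) :
    x ∈ coneGen (fun i => toReal (Fin.cons (a i : ℤ) (Pi.single i (d : ℤ)))) ↔
      (∀ i : Fin k, 0 ≤ x i.succ) ∧ d * x 0 = ∑ i, a i * x i.succ := by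
  have hd' : (0 : ℝ) < d := by exact_mod_cast hd
  constructor
  · rintro ⟨c, hc, rfl⟩
    have hs : ∀ j : Fin k, (∑ i, c i • toReal (Fin.cons (a i : ℤ) (Pi.single i (d : ℤ))) :
        Fin (k + 1) → ℝ) j.succ = c j * d := by
      intro j
      simp [Finset.sum_apply, toReal, Pi.single_apply]
    refine ⟨fun j => ?_, ?_⟩
    · rw [hs]
      exact mul_nonneg (hc j) hd'.le
    · simp only [hs]
      simp only [Finset.sum_apply, Pi.smul_apply, toReal, Fin.cons_zero, smul_eq_mul,
        Int.cast_natCast, Finset.mul_sum]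
      exact Finset.sum_congr rfl fun i _ => by ring
  · rintro ⟨hx, h0⟩
    refine ⟨fun i => x i.succ / d, fun i => div_nonneg (hx i) hd'.le, ?_⟩
    ext j
    refine Fin.cases ?_ (fun j => ?_) j
    · simp only [Finset.sum_apply, Pi.smul_apply, toReal, Fin.cons_zero, smul_eq_mul,
        Int.cast_natCast]
      rw [← mul_right_inj' hd'.ne', h0, Finset.mul_sum]
      exact Finset.sum_congr rfl fun i _ => by field_simp
    · simp [Finset.sum_apply, toReal, Pi.single_apply, hd'.ne']

/-- every `k`-quotient numerical semigroup is `k`-ray-normalescent: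
there are `m ≥ 1`, a cone `C ⊆ ℝ^m` generated by `k` integer vectors, and an integer
linear functional `π` nonnegative on `C`, with `S = π(C ∩ ℤ^m)`. -/
theorem kQuotient_is_kRayNormalescent (k : ℕ) (S : Set ℕ)
    (hS : IsNumericalSemigroup S) (h : IsKQuotient k S) :
    ∃ (m : ℕ), 1 ≤ m ∧ ∃ (v : Fin k → (Fin m → ℤ)) (p : Fin m → ℤ),
      (∀ x ∈ coneGen (fun i => toReal (v i)), 0 ≤ ∑ j, (p j : ℝ) * x j) ∧
      {t : ℤ | ∃ z : Fin m → ℤ, toReal z ∈ coneGen (fun i => toReal (v i)) ∧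
          t = ∑ j, p j * z j} = (fun n : ℕ => (n : ℤ)) '' S := by
  obtain ⟨d, a, hd, -, rfl⟩ := h
  have hd' : (0 : ℝ) < d := by exact_mod_cast hd
  refine ⟨k + 1, by omega, fun i => Fin.cons (a i : ℤ) (Pi.single i (d : ℤ)),
    Pi.single 0 1, fun x hx => ?_, ?_⟩
  · obtain ⟨hx, h0⟩ := (mem_coneGen_cons_single hd a x).1 hx
    have : 0 ≤ d * x 0 := h0 ▸ Finset.sum_nonneg fun i _ => mul_nonneg (Nat.cast_nonneg _) (hx i)
    simpa [Pi.single_apply] using nonneg_of_mul_nonneg_right this hd'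
  · ext t
    simp only [mem_coneGen_cons_single hd a, Set.mem_ofPred_eq, Set.mem_image, numQuot, numGen]
    constructor
    · rintro ⟨z, ⟨hz, h0⟩, rfl⟩
      have hz' : ∀ i : Fin k, 0 ≤ z i.succ := fun i => Int.cast_nonneg_iff.1 (hz i)
      have h0' : (d : ℤ) * z 0 = ∑ i, (a i : ℤ) * z i.succ := by
        simp only [toReal] at h0
        exact_mod_cast h0
      have hz0 : 0 ≤ z 0 := by
        refine nonneg_of_mul_nonneg_right (a := (d : ℤ)) ?_ (by exact_mod_cast hd)
        exact h0' ▸ Finset.sum_nonneg fun i _ => mul_nonneg (Nat.cast_nonneg _) (hz' i)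
      refine ⟨(z 0).toNat, ⟨fun i => (z i.succ).toNat, ?_⟩, by simp [Pi.single_apply, hz0]⟩
      zify
      simpa [hz0, hz'] using h0'
    · rintro ⟨n, ⟨x, hx⟩, rfl⟩
      refine ⟨Fin.cons (n : ℤ) fun i => (x i : ℤ), ⟨fun i => by simp [toReal], ?_⟩,
        by simp [Pi.single_apply]⟩
      simp only [toReal, Fin.cons_zero, Fin.cons_succ, Int.cast_natCast]
      exact_mod_cast hx
end

section
/- If the numerical semigroup S₁ is k₁-normalescent and the numerical semigroup S₂ is k₂-normalescent, then the numerical semigroup S₁ + S₂ = {s₁ + s₂ : s₁ ∈ S₁, s₂ ∈ S₂} is (k₁+k₂)-normalescent. -/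
open scoped BigOperators

/-- Concatenation of real vectors as a linear map. -/
def appendLinearMap (m₁ m₂ : ℕ) :
    ((Fin m₁ → ℝ) × (Fin m₂ → ℝ)) →ₗ[ℝ] (Fin (m₁ + m₂) → ℝ) where
  toFun x := Fin.append x.1 x.2
  map_add' x y := by
    ext j
    refine Fin.addCases (fun i => ?_) (fun i => ?_) j <;> simp
  map_smul' c x := by
    ext j
    refine Fin.addCases (fun i => ?_) (fun i => ?_) j <;> simp

theorem append_inj {m₁ m₂ : ℕ} {x x' : Fin m₁ → ℝ} {y y' : Fin m₂ → ℝ} :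
    Fin.append x y = Fin.append x' y' ↔ x = x' ∧ y = y' := by
  refine ⟨fun h => ⟨?_, ?_⟩, fun h => by rw [h.1, h.2]⟩
  · ext i
    simpa using congrFun h (Fin.castAdd m₂ i)
  · ext i
    simpa using congrFun h (Fin.natAdd m₁ i)

theorem appendLinearMap_injective (m₁ m₂ : ℕ) :
    Function.Injective (appendLinearMap m₁ m₂) := fun _ _ h =>
  Prod.ext (append_inj.1 h).1 (append_inj.1 h).2

theorem exists_eq_append {α : Type*} {m₁ m₂ : ℕ} (x : Fin (m₁ + m₂) → α) :
    ∃ (y : Fin m₁ → α) (z : Fin m₂ → α), x = Fin.append y z :=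
  ⟨_, _, (Fin.append_castAdd_natAdd (f := x)).symm⟩

/-- The block-diagonal family formed from two families of vectors. -/
def blockFamily {R : Type*} [Zero R] {m₁ m₂ l₁ l₂ : ℕ} (v : Fin l₁ → Fin m₁ → R)
    (w : Fin l₂ → Fin m₂ → R) : Fin (l₁ + l₂) → Fin (m₁ + m₂) → R :=
  Fin.append (fun i => Fin.append (v i) 0) (fun i => Fin.append 0 (w i))

theorem toReal_append {m₁ m₂ : ℕ} (x : Fin m₁ → ℤ) (y : Fin m₂ → ℤ) :
    toReal (Fin.append x y) = Fin.append (toReal x) (toReal y) := by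
  ext j
  refine Fin.addCases (fun i => ?_) (fun i => ?_) j <;> simp [toReal]

theorem toReal_blockFamily {m₁ m₂ l₁ l₂ : ℕ} (v : Fin l₁ → Fin m₁ → ℤ)
    (w : Fin l₂ → Fin m₂ → ℤ) :
    (fun i => toReal (blockFamily v w i)) =
      blockFamily (fun i => toReal (v i)) (fun i => toReal (w i)) := by
  have h₀ (m : ℕ) : toReal (0 : Fin m → ℤ) = 0 := by
    ext
    simp [toReal]
  ext1 j
  refine Fin.addCases (fun i => ?_) (fun i => ?_) j <;>
    simp [blockFamily, toReal_append, h₀]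

theorem sum_smul_blockFamily {m₁ m₂ l₁ l₂ : ℕ} (v : Fin l₁ → Fin m₁ → ℝ)
    (w : Fin l₂ → Fin m₂ → ℝ) (a : Fin l₁ → ℝ) (b : Fin l₂ → ℝ) :
    ∑ i, Fin.append a b i • blockFamily v w i =
      Fin.append (∑ i, a i • v i) (∑ i, b i • w i) := by
  ext j
  rw [Fin.sum_univ_add]
  refine Fin.addCases (fun i => ?_) (fun i => ?_) j <;> simp [blockFamily]

theorem append_mem_coneGen_blockFamily {m₁ m₂ l₁ l₂ : ℕ} {v : Fin l₁ → Fin m₁ → ℝ}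
    {w : Fin l₂ → Fin m₂ → ℝ} {x : Fin m₁ → ℝ} {y : Fin m₂ → ℝ} :
    Fin.append x y ∈ coneGen (blockFamily v w) ↔ x ∈ coneGen v ∧ y ∈ coneGen w := by
  constructor
  · rintro ⟨c, hc, h⟩
    obtain ⟨a, b, rfl⟩ := exists_eq_append c
    rw [sum_smul_blockFamily, append_inj] at h
    exact ⟨⟨a, fun i => by simpa using hc (Fin.castAdd l₂ i), h.1⟩,
      ⟨b, fun i => by simpa using hc (Fin.natAdd l₁ i), h.2⟩⟩
  · rintro ⟨⟨a, ha, rfl⟩, ⟨b, hb, rfl⟩⟩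
    refine ⟨Fin.append a b, fun j => ?_, (sum_smul_blockFamily v w a b).symm⟩
    refine Fin.addCases (fun i => ?_) (fun i => ?_) j
    · simpa using ha i
    · simpa using hb i

theorem range_append {α : Type*} {m n : ℕ} (f : Fin m → α) (g : Fin n → α) :
    Set.range (Fin.append f g) = Set.range f ∪ Set.range g := by
  rw [← Set.Sum.elim_range, ← Fin.append_comp_sumElim]
  exact (finSumFinEquiv.surjective.range_comp (Fin.append f g)).symm

theorem span_range_blockFamily {m₁ m₂ l₁ l₂ : ℕ} (v : Fin l₁ → Fin m₁ → ℝ)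
    (w : Fin l₂ → Fin m₂ → ℝ) :
    Submodule.span ℝ (Set.range (blockFamily v w)) =
      ((Submodule.span ℝ (Set.range v)).prod (Submodule.span ℝ (Set.range w))).map
        (appendLinearMap m₁ m₂) := by
  rw [← LinearMap.span_inl_union_inr, Submodule.map_span, Set.image_union, blockFamily,
    range_append]
  simp only [← Set.range_comp]
  rfl

theorem finrank_span_range_blockFamily {m₁ m₂ l₁ l₂ : ℕ} (v : Fin l₁ → Fin m₁ → ℝ)
    (w : Fin l₂ → Fin m₂ → ℝ) :
    Module.finrank ℝ (Submodule.span ℝ (Set.range (blockFamily v w))) =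
      Module.finrank ℝ (Submodule.span ℝ (Set.range v)) +
        Module.finrank ℝ (Submodule.span ℝ (Set.range w)) := by
  rw [span_range_blockFamily]
  set V := Submodule.span ℝ (Set.range v)
  set W := Submodule.span ℝ (Set.range w)
  have h : V.prod W = LinearMap.range (V.subtype.prodMap W.subtype) := by
    simp [LinearMap.range_prodMap]
  rw [h, ← LinearMap.range_comp, LinearMap.finrank_range_of_inj, Module.finrank_prod]
  exact (appendLinearMap_injective m₁ m₂).comp
    (V.injective_subtype.prodMap W.injective_subtype)

/-- the sum of a `k₁`-normalescent and a `k₂`-normalescent numerical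
semigroup is `(k₁+k₂)`-normalescent. -/
theorem sum_normalescent (k₁ k₂ : ℕ) (S₁ S₂ : Set ℕ)
    (hS₁ : IsNumericalSemigroup S₁) (hS₂ : IsNumericalSemigroup S₂)
    (h₁ : IsKNormalescent k₁ S₁) (h₂ : IsKNormalescent k₂ S₂) :
    IsKNormalescent (k₁ + k₂) {n : ℕ | ∃ s₁ ∈ S₁, ∃ s₂ ∈ S₂, n = s₁ + s₂} := by
  obtain ⟨m₁, l₁, v, p, hv, hp, hS⟩ := h₁
  obtain ⟨m₂, l₂, w, q, hw, hq, hT⟩ := h₂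
  refine ⟨m₁ + m₂, l₁ + l₂, blockFamily v w, Fin.append p q, ?_, ?_, ?_⟩
  · rw [toReal_blockFamily, finrank_span_range_blockFamily, hv, hw]
  · intro x hx
    obtain ⟨y, z, rfl⟩ := exists_eq_append x
    rw [toReal_blockFamily, append_mem_coneGen_blockFamily] at hx
    simpa [Fin.sum_univ_add] using add_nonneg (hp y hx.1) (hq z hx.2)
  · rw [toReal_blockFamily]
    ext t
    constructor
    · rintro ⟨x, hx, rfl⟩
      obtain ⟨y, z, rfl⟩ := exists_eq_append x
      rw [toReal_append, append_mem_coneGen_blockFamily] at hx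
      obtain ⟨s₁, hs₁, e₁⟩ := hS.subset ⟨y, hx.1, rfl⟩
      obtain ⟨s₂, hs₂, e₂⟩ := hT.subset ⟨z, hx.2, rfl⟩
      refine ⟨s₁ + s₂, ⟨s₁, hs₁, s₂, hs₂, rfl⟩, ?_⟩
      simpa [Fin.sum_univ_add] using congrArg₂ (· + ·) e₁ e₂
    · rintro ⟨_, ⟨s₁, hs₁, s₂, hs₂, rfl⟩, rfl⟩
      obtain ⟨y, hy, e₁⟩ := hS.superset ⟨s₁, hs₁, rfl⟩
      obtain ⟨z, hz, e₂⟩ := hT.superset ⟨s₂, hs₂, rfl⟩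
      refine ⟨Fin.append y z, ?_, ?_⟩
      · rw [toReal_append, append_mem_coneGen_blockFamily]
        exact ⟨hy, hz⟩
      · simpa [Fin.sum_univ_add] using congrArg₂ (· + ·) e₁ e₂
end

section
/- If the numerical semigroup S₁ is a k₁-quotient and the numerical semigroup S₂ is a k₂-quotient, then the numerical semigroup S₁ + S₂ = {s₁ + s₂ : s₁ ∈ S₁, s₂ ∈ S₂} is a (k₁+k₂)-quotient. -/
open scoped BigOperators

theorem exists_mem_numGen_of_ge {k : ℕ} (a : Fin k → ℕ) :
    ∃ B, ∀ t ≥ B, Nat.setGcd (Set.range a) ∣ t → t ∈ numGen a := by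
  obtain ⟨B, hB⟩ := Nat.exists_mem_closure_of_ge (Set.range a)
  refine ⟨B, fun t ht hd => ?_⟩
  obtain ⟨x, hx⟩ := AddSubmonoid.exists_of_mem_closure_range a t (hB t ht hd)
  exact ⟨x, by simp [hx, mul_comm]⟩

theorem mul_mem_numGen_mul_iff {k : ℕ} {e : ℕ} (he : 0 < e) (a : Fin k → ℕ) (t : ℕ) :
    e * t ∈ numGen (fun i => e * a i) ↔ t ∈ numGen a := by
  simp only [numGen, Set.mem_ofPred_eq, mul_assoc, ← Finset.mul_sum]
  exact exists_congr fun x => mul_right_inj' he.ne'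

/-- A quotient representation can be reduced to lowest terms. -/
theorem IsKQuotient.exists_coprime_setGcd {k : ℕ} {S : Set ℕ} (h : IsKQuotient k S) :
    ∃ (d : ℕ) (a : Fin k → ℕ), 0 < d ∧ (∀ i, 0 < a i) ∧ S = numQuot (numGen a) d ∧
      d.Coprime (Nat.setGcd (Set.range a)) := by
  obtain ⟨d, a, hd, ha, rfl⟩ := h
  obtain ⟨e, he⟩ : ∃ e, e = Nat.gcd d (Nat.setGcd (Set.range a)) := ⟨_, rfl⟩
  have he0 : 0 < e := he ▸ Nat.gcd_pos_of_pos_left _ hd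
  obtain ⟨d', hd'⟩ : e ∣ d := he ▸ Nat.gcd_dvd_left _ _
  have hea : ∀ i, e ∣ a i := fun i =>
    he ▸ (Nat.gcd_dvd_right _ _).trans (Nat.setGcd_dvd_of_mem ⟨i, rfl⟩)
  choose b hb using hea
  obtain rfl : a = fun i => e * b i := funext hb
  refine ⟨d', b, Nat.pos_of_mul_pos_left (hd' ▸ hd), fun i => Nat.pos_of_mul_pos_left (ha i),
    ?_, ?_⟩
  · ext t
    simp only [numQuot, Set.mem_ofPred_eq]
    rw [hd', mul_assoc, mul_mem_numGen_mul_iff he0]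
  · refine Nat.coprime_of_dvd fun p hp hpd hpb => hp.one_lt.ne' ?_
    have : e * p ∣ e := by
      conv_rhs => rw [he]
      refine Nat.dvd_gcd (hd' ▸ mul_dvd_mul_left e hpd) (Nat.dvd_setGcd_iff.2 ?_)
      rintro _ ⟨i, rfl⟩
      exact mul_dvd_mul_left e (hpb.trans (Nat.setGcd_dvd_of_mem ⟨i, rfl⟩))
    exact Nat.dvd_one.1 (Nat.dvd_of_mul_dvd_mul_left he0 (by simpa using this))

theorem exists_injective_primes_modEq_one {n : ℕ} (hn : n ≠ 0) (k N : ℕ) :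
    ∃ m : Fin k → ℕ, Function.Injective m ∧ ∀ i, (m i).Prime ∧ N < m i ∧ m i ≡ 1 [MOD n] := by
  have hinf : {p : ℕ | p.Prime ∧ N < p ∧ p ≡ 1 [MOD n]}.Infinite := by
    refine Set.infinite_of_not_bddAbove fun ⟨M, hM⟩ => ?_
    obtain ⟨p, hp, hlt, hmod⟩ := Nat.exists_prime_gt_modEq_one (M + N) hn
    have := hM ⟨hp, by omega, hmod⟩
    omega
  exact ⟨fun i => hinf.natEmbedding _ i,
    fun i j hij => Fin.ext ((hinf.natEmbedding _).injective (Subtype.ext hij)),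
    fun i => (hinf.natEmbedding _ i).2⟩

section Perturbation

variable {k : ℕ} (d : ℕ) (a s m : Fin k → ℕ)

/-- The product of all `m j` with `j ≠ i`. -/
def cofactor (i : Fin k) : ℕ := ∏ j ∈ Finset.univ.erase i, m j

/-- The denominator `d ∏ mᵢ + ∑ aᵢ (∏_{j ≠ i} mⱼ) sᵢ` obtained from `d t = ∑ aᵢ xᵢ` by the
substitution `wᵢ = mᵢ xᵢ + sᵢ t`. -/
def perturbedDenom : ℕ := d * ∏ i, m i + ∑ i, a i * cofactor m i * s i

theorem mul_cofactor (i : Fin k) : m i * cofactor m i = ∏ j, m j :=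
  Finset.mul_prod_erase _ _ (Finset.mem_univ i)

variable {d a s m}

theorem perturbedDenom_modEq {n : ℕ} (hm : ∀ i, m i ≡ 1 [MOD n]) :
    perturbedDenom d a s m ≡ d + ∑ i, a i * s i [MOD n] := by
  have hm' : ∀ i, (m i : ZMod n) = 1 := fun i => by
    simpa using (ZMod.natCast_eq_natCast_iff _ _ _).2 (hm i)
  rw [← ZMod.natCast_eq_natCast_iff]
  simp [perturbedDenom, cofactor, hm']

theorem perturbedDenom_mul_mem {t : ℕ} (ht : d * t ∈ numGen a) :
    perturbedDenom d a s m * t ∈ numGen fun i => a i * cofactor m i := by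
  obtain ⟨x, hx⟩ := ht
  refine ⟨fun i => m i * x i + s i * t, ?_⟩
  rw [perturbedDenom, add_mul, mul_right_comm, hx, Finset.sum_mul, Finset.sum_mul,
    ← Finset.sum_add_distrib]
  refine Finset.sum_congr rfl fun i _ => ?_
  rw [← mul_cofactor m i]
  ring

theorem mem_of_perturbedDenom_mul_mem {B t : ℕ} (hd : 0 < d)
    (hB : ∀ u ≥ B, Nat.setGcd (Set.range a) ∣ u → u ∈ numGen a) (ha : ∀ i, 0 < a i)
    (hinj : Function.Injective m) (hp : ∀ i, (m i).Prime) (ham : ∀ i, a i < m i)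
    (hsm : ∀ i, s i * B < m i)
    (ht : perturbedDenom d a s m * t ∈ numGen fun i => a i * cofactor m i) :
    d * t ∈ numGen a := by
  obtain ⟨w, hw⟩ := ht
  have hsum : ∑ i, (a i * cofactor m i : ℤ) * (w i - s i * t) = d * (∏ i, m i : ℕ) * t := by
    have : ((perturbedDenom d a s m * t : ℕ) : ℤ) = (∑ i, a i * cofactor m i * w i : ℕ) := by
      rw [hw]
    rw [perturbedDenom] at this
    push_cast [add_mul, Finset.sum_mul] at this
    push_cast
    simp only [mul_sub, Finset.sum_sub_distrib, ← this, ← mul_assoc]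
    ring
  have hdvd : ∀ i, (m i : ℤ) ∣ w i - s i * t := by
    intro i
    have hpi := Nat.prime_iff_prime_int.1 (hp i)
    have h1 : (m i : ℤ) ∣ (a i * cofactor m i : ℤ) * (w i - s i * t) := by
      have h2 : (m i : ℤ) ∣ ∑ j, (a j * cofactor m j : ℤ) * (w j - s j * t) := by
        rw [hsum, ← mul_cofactor m i]
        exact ⟨d * cofactor m i * t, by push_cast; ring⟩
      rw [← Finset.add_sum_erase _ _ (Finset.mem_univ i)] at h2
      refine (dvd_add_left (Finset.dvd_sum fun j hj => ?_)).1 h2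
      refine Dvd.dvd.mul_right (Dvd.dvd.mul_left (Int.natCast_dvd_natCast.2 ?_) _) _
      exact Finset.dvd_prod_of_mem m (Finset.mem_erase.2 ⟨(Finset.ne_of_mem_erase hj).symm,
        Finset.mem_univ i⟩)
    refine (hpi.dvd_or_dvd h1).resolve_left fun h => ?_
    have h3 : m i ∣ a i * cofactor m i := by exact_mod_cast h
    rcases (hp i).dvd_mul.1 h3 with h4 | h4
    · exact (Nat.le_of_dvd (ha i) h4).not_gt (ham i)
    · obtain ⟨j, hj, hij⟩ := ((hp i).prime.dvd_finsetProd_iff _).1 h4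
      exact Finset.ne_of_mem_erase hj
        (hinj ((Nat.prime_dvd_prime_iff_eq (hp i) (hp j)).1 hij).symm)
  choose x hx using hdvd
  have hprod : ((∏ i, m i : ℕ) : ℤ) ≠ 0 := by
    exact_mod_cast (Finset.prod_pos fun i _ => (hp i).pos).ne'
  have hdt : (d * t : ℤ) = ∑ i, a i * x i := by
    refine mul_left_cancel₀ hprod ?_
    rw [Finset.mul_sum]
    calc ((∏ i, m i : ℕ) : ℤ) * (d * t) = d * (∏ i, m i : ℕ) * t := by ring
      _ = _ := by
        rw [← hsum]
        refine Finset.sum_congr rfl fun i _ => ?_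
        rw [hx, ← mul_cofactor m i]
        push_cast
        ring
  rcases le_or_gt B t with hBt | hBt
  · refine hB _ (hBt.trans (Nat.le_mul_of_pos_left t hd)) ?_
    rw [← Int.natCast_dvd_natCast]
    push_cast
    rw [hdt]
    exact Finset.dvd_sum fun i _ =>
      (Int.natCast_dvd_natCast.2 (Nat.setGcd_dvd_of_mem (Set.mem_range_self i))).mul_right _
  · have hx0 : ∀ i, 0 ≤ x i := by
      intro i
      by_contra! hneg
      have h1 : (s i * t : ℤ) ≤ s i * B := by gcongr
      have h2 : (s i * B : ℤ) < m i := by exact_mod_cast hsm i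
      have h3 : (0 : ℤ) ≤ w i := by positivity
      nlinarith [hx i, (by positivity : (0 : ℤ) ≤ m i)]
    lift x to Fin k → ℕ using hx0
    refine ⟨x, ?_⟩
    beta_reduce at hdt
    exact_mod_cast hdt

end Perturbation

/-- The denominator of a `k`-quotient can be chosen coprime to any given positive integer. -/
theorem IsKQuotient.exists_coprime {k : ℕ} {S : Set ℕ} (h : IsKQuotient k S) {n : ℕ}
    (hn : 0 < n) :
    ∃ (d : ℕ) (a : Fin k → ℕ), 0 < d ∧ (∀ i, 0 < a i) ∧ S = numQuot (numGen a) d ∧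
      d.Coprime n := by
  obtain ⟨d, a, hd, ha, rfl, hco⟩ := h.exists_coprime_setGcd
  rcases eq_or_ne (Nat.setGcd (Set.range a)) 0 with h0 | h0
  · rw [h0, Nat.coprime_zero_right] at hco
    exact ⟨d, a, hd, ha, rfl, by simp [hco]⟩
  obtain ⟨B, hB⟩ := exists_mem_numGen_of_ge a
  obtain ⟨p, hpgt, hp, hpmod⟩ := Nat.forall_exists_prime_gt_and_modEq (n + d + B) h0 hco
  obtain ⟨s, hs⟩ := hB (p - d) (by omega) ((Nat.modEq_iff_dvd' (by omega)).1 hpmod.symm)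
  obtain ⟨m, hinj, hm⟩ := exists_injective_primes_modEq_one hn.ne' k (∑ i, (a i + s i * B))
  have hle : ∀ i, a i + s i * B < m i := fun i =>
    (Finset.single_le_sum (f := fun i => a i + s i * B) (fun _ _ => Nat.zero_le _)
      (Finset.mem_univ i)).trans_lt (hm i).2.1
  have hprod : ∀ t : Finset (Fin k), 0 < ∏ j ∈ t, m j := fun t =>
    Finset.prod_pos fun j _ => (hm j).1.pos
  refine ⟨perturbedDenom d a s m, fun i => a i * cofactor m i,
    Nat.add_pos_left (Nat.mul_pos hd (hprod _)) _, fun i => Nat.mul_pos (ha i) (hprod _), ?_, ?_⟩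
  · ext t
    refine ⟨perturbedDenom_mul_mem, mem_of_perturbedDenom_mul_mem hd hB ha hinj
      (fun i => (hm i).1) (fun i => ?_) (fun i => ?_)⟩
    · have := hle i
      omega
    · have := hle i
      have := ha i
      omega
  · have hmod := perturbedDenom_modEq (d := d) (a := a) (s := s) fun i => (hm i).2.2
    rw [← hs, Nat.add_sub_cancel' (by omega)] at hmod
    rw [Nat.Coprime, hmod.gcd_eq]
    exact (hp.coprime_iff_not_dvd).2 (Nat.not_dvd_of_pos_of_lt hn (by omega))

/-- the sum of a `k₁`-quotient and a `k₂`-quotient is a `(k₁+k₂)`-quotient. -/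
theorem sum_quotient (k₁ k₂ : ℕ) (S₁ S₂ : Set ℕ)
    (hS₁ : IsNumericalSemigroup S₁) (hS₂ : IsNumericalSemigroup S₂)
    (h₁ : IsKQuotient k₁ S₁) (h₂ : IsKQuotient k₂ S₂) :
    IsKQuotient (k₁ + k₂) {n : ℕ | ∃ s₁ ∈ S₁, ∃ s₂ ∈ S₂, n = s₁ + s₂} := by
  obtain ⟨d₂, b, hd₂, hb, rfl⟩ := h₂
  obtain ⟨d₁, a, hd₁, ha, rfl, hco⟩ := h₁.exists_coprime hd₂
  refine ⟨d₁ * d₂, Fin.append (fun i => d₂ * a i) (fun i => d₁ * b i), Nat.mul_pos hd₁ hd₂,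
    fun i => ?_, ?_⟩
  · refine Fin.addCases (fun i => ?_) (fun i => ?_) i
    · simpa using ⟨hd₂, ha i⟩
    · simpa using ⟨hd₁, hb i⟩
  ext t
  simp only [numQuot, numGen, Set.mem_ofPred_eq, Fin.sum_univ_add, Fin.append_left,
    Fin.append_right, mul_assoc, ← Finset.mul_sum]
  constructor
  · rintro ⟨s₁, ⟨x, hx⟩, s₂, ⟨y, hy⟩, rfl⟩
    refine ⟨Fin.append x y, ?_⟩
    simp only [Fin.append_left, Fin.append_right, ← hx, ← hy]
    ring
  · rintro ⟨w, hw⟩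
    obtain ⟨s₁, hs₁⟩ : d₁ ∣ ∑ i, a i * w (Fin.castAdd k₂ i) := by
      refine hco.dvd_of_dvd_mul_left
        ((Nat.dvd_add_left (dvd_mul_right d₁ (∑ i, b i * w (Fin.natAdd k₁ i)))).1 ?_)
      exact hw ▸ dvd_mul_right d₁ _
    obtain ⟨s₂, hs₂⟩ : d₂ ∣ ∑ i, b i * w (Fin.natAdd k₁ i) := by
      refine hco.symm.dvd_of_dvd_mul_left
        ((Nat.dvd_add_right (dvd_mul_right d₂ (∑ i, a i * w (Fin.castAdd k₂ i)))).1 ?_)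
      exact hw ▸ ⟨d₁ * t, by ring⟩
    refine ⟨s₁, ⟨_, hs₁.symm⟩, s₂, ⟨_, hs₂.symm⟩, ?_⟩
    rw [hs₁, hs₂] at hw
    refine Nat.eq_of_mul_eq_mul_left (Nat.mul_pos hd₁ hd₂) ?_
    linear_combination hw
end

section
/- The numerical semigroup S = ⟨101, 102, 110, 111⟩ is 3-normalescent: there exist m, a 3-dimensional rational polyhedral cone C ⊆ ℝ^m, and a linear map π : ℝ^m → ℝ with integer coefficients satisfying π(C) ⊆ ℝ_{≥0}, such that S = π(C ∩ ℤ^m). Concretely, taking C ⊆ ℝ³ to be the cone generated by (101,1,0), (102,1,0), (110,0,1), (111,0,1) and π the projection onto the first coordinate, one has π(C ∩ ℤ³) = ⟨101, 102, 110, 111⟩. -/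
open scoped BigOperators

/-- The integer generators of the cone. -/
def coneVec : Fin 4 → Fin 3 → ℤ := ![![101,1,0], ![102,1,0], ![110,0,1], ![111,0,1]]

theorem mem_coneGen_coneVec_iff (x : Fin 3 → ℝ) :
    x ∈ coneGen (fun i => toReal (coneVec i)) ↔
      ∃ c : Fin 4 → ℝ, (∀ i, 0 ≤ c i) ∧
        x 0 = 101 * c 0 + 102 * c 1 + 110 * c 2 + 111 * c 3 ∧
        x 1 = c 0 + c 1 ∧ x 2 = c 2 + c 3 := by
  simp only [coneGen, Set.mem_ofPred_eq, funext_iff, Fin.forall_fin_succ (n := 2)]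
  refine exists_congr fun c => and_congr_right fun _ => ?_
  simp [Fin.sum_univ_four, coneVec, toReal, Fin.forall_fin_two, mul_comm]

theorem image_coneVec_eq_numGen :
    {t : ℤ | ∃ z : Fin 3 → ℤ, toReal z ∈ coneGen (fun i => toReal (coneVec i)) ∧ t = z 0}
      = (fun n : ℕ => (n : ℤ)) '' numGen ![101, 102, 110, 111] := by
  ext t
  simp only [Set.mem_ofPred_eq, Set.mem_image, mem_coneGen_coneVec_iff, numGen, toReal]
  constructor
  · rintro ⟨z, ⟨c, hc, h0, h1, h2⟩, rfl⟩
    have c0 := hc 0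
    have c1 := hc 1
    have c2 := hc 2
    have c3 := hc 3
    have ha : 0 ≤ z 1 := by exact_mod_cast (by linarith : (0 : ℝ) ≤ z 1)
    have hb : 0 ≤ z 2 := by exact_mod_cast (by linarith : (0 : ℝ) ≤ z 2)
    have hl : 101 * z 1 + 110 * z 2 ≤ z 0 := by
      exact_mod_cast (by linarith : (101 : ℝ) * z 1 + 110 * z 2 ≤ z 0)
    have hu : z 0 ≤ 102 * z 1 + 111 * z 2 := by
      exact_mod_cast (by linarith : (z 0 : ℝ) ≤ 102 * z 1 + 111 * z 2)
    obtain ⟨m, n, hm, hma, hn, hnb, h⟩ : ∃ m n : ℤ, 0 ≤ m ∧ m ≤ z 1 ∧ 0 ≤ n ∧ n ≤ z 2 ∧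
        z 0 = 101 * z 1 + 110 * z 2 + m + n :=
      ⟨min (z 0 - 101 * z 1 - 110 * z 2) (z 1),
        z 0 - 101 * z 1 - 110 * z 2 - min (z 0 - 101 * z 1 - 110 * z 2) (z 1),
        by omega, by omega, by omega, by omega, by omega⟩
    refine ⟨(z 0).toNat, ⟨![(z 1 - m).toNat, m.toNat, (z 2 - n).toNat, n.toNat], ?_⟩, by omega⟩
    simp [Fin.sum_univ_four]
    omega
  · rintro ⟨_, ⟨x, rfl⟩, rfl⟩
    refine ⟨![101 * x 0 + 102 * x 1 + 110 * x 2 + 111 * x 3, x 0 + x 1, x 2 + x 3],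
      ⟨fun i => x i, fun i => Nat.cast_nonneg _, ?_, ?_, ?_⟩, ?_⟩ <;>
    simp [Fin.sum_univ_four]

theorem span_coneVec_eq_top :
    Submodule.span ℝ (Set.range (fun i => toReal (coneVec i))) = ⊤ := by
  rw [eq_top_iff]
  rintro x -
  rw [Submodule.mem_span_range_iff_exists_fun]
  refine ⟨![x 1 - (x 0 - 101 * x 1 - 110 * x 2), x 0 - 101 * x 1 - 110 * x 2, x 2, 0], ?_⟩
  ext j
  fin_cases j <;> simp [Fin.sum_univ_four, coneVec, toReal]
  all_goals ring

/-- `⟨101, 102, 110, 111⟩` is 3-normalescent; concretely, the cone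
`C ⊆ ℝ³` generated by `(101,1,0), (102,1,0), (110,0,1), (111,0,1)`, with `π`
the projection onto the first coordinate, satisfies `π(C ∩ ℤ³) = ⟨101,102,110,111⟩`. -/
theorem example_3normalescent :
    IsKNormalescent 3 (numGen ![101, 102, 110, 111]) ∧
    {t : ℤ | ∃ z : Fin 3 → ℤ,
        toReal z ∈ coneGen (fun i =>
          toReal ((![![101,1,0], ![102,1,0], ![110,0,1], ![111,0,1]] :
            Fin 4 → Fin 3 → ℤ) i)) ∧ t = z 0}
      = (fun n : ℕ => (n : ℤ)) '' numGen ![101, 102, 110, 111] := by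
  refine ⟨⟨3, 4, coneVec, ![1, 0, 0], ?_, ?_, ?_⟩, image_coneVec_eq_numGen⟩
  · rw [span_coneVec_eq_top, finrank_top, Module.finrank_fin_fun]
  · intro x hx
    obtain ⟨c, hc, h0, -, -⟩ := (mem_coneGen_coneVec_iff x).1 hx
    have c0 := hc 0
    have c1 := hc 1
    have c2 := hc 2
    have c3 := hc 3
    simp only [Fin.sum_univ_three, Matrix.cons_val, Int.cast_one, Int.cast_zero]
    linarith
  · simpa [Fin.sum_univ_three] using image_coneVec_eq_numGen
end

section
/- If a numerical semigroup S is k-normalescent and gcd(S) = d, then there exists a full-dimensional rational polyhedral cone C ⊆ ℝ^k such that S = π(C ∩ ℤ^k), where π : ℝ^k → ℝ is the map π(x) = d·x₁ (d times the first coordinate). -/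
open scoped BigOperators

/-- The coercion `toReal` as a `ℤ`-linear map. -/
noncomputable def toRealLinearMap (m : ℕ) : (Fin m → ℤ) →ₗ[ℤ] (Fin m → ℝ) :=
  (Algebra.linearMap ℤ ℝ).compLeft (Fin m)

@[simp]
lemma toRealLinearMap_apply {m : ℕ} (z : Fin m → ℤ) : toRealLinearMap m z = toReal z := rfl

/-- The lattice of integer points of a real subspace. -/
noncomputable def integerPoints {m : ℕ} (W : Submodule ℝ (Fin m → ℝ)) :
    Submodule ℤ (Fin m → ℤ) :=
  (W.restrictScalars ℤ).comap (toRealLinearMap m)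

@[simp]
lemma mem_integerPoints {m : ℕ} {W : Submodule ℝ (Fin m → ℝ)} {z : Fin m → ℤ} :
    z ∈ integerPoints W ↔ toReal z ∈ W := Iff.rfl

lemma linearIndependent_toReal {m : ℕ} {ι : Type*} {v : ι → Fin m → ℤ}
    (hv : LinearIndependent ℤ v) : LinearIndependent ℝ (fun i => toReal (v i)) := by
  have h := (linearIndependent_algebraMap_comp_iff (S := ℝ)).2 hv
  exact h

lemma linearIndependent_toReal_basis {m : ℕ} {ι : Type*} {N : Submodule ℤ (Fin m → ℤ)}
    (b : Module.Basis ι ℤ N) :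
    LinearIndependent ℝ (fun i => toReal (b i : Fin m → ℤ)) :=
  linearIndependent_toReal (b.linearIndependent.map' N.subtype N.ker_subtype)

lemma sum_repr_smul_toReal {m : ℕ} {ι : Type*} [Fintype ι] {N : Submodule ℤ (Fin m → ℤ)}
    (b : Module.Basis ι ℤ N) (z : N) :
    ∑ j, (b.repr z j : ℝ) • toReal (b j : Fin m → ℤ) = toReal (z : Fin m → ℤ) := by
  conv_rhs => rw [← b.sum_repr z]
  simp_rw [← toRealLinearMap_apply, ← N.subtype_apply, map_sum, map_smul, Int.cast_smul_eq_zsmul]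

lemma span_toReal_basis_integerPoints {m : ℕ} {ι κ : Type*} [Fintype ι] (v : κ → Fin m → ℤ)
    (b : Module.Basis ι ℤ
      (integerPoints (Submodule.span ℝ (Set.range fun i => toReal (v i))))) :
    Submodule.span ℝ (Set.range fun i => toReal (b i : Fin m → ℤ)) =
      Submodule.span ℝ (Set.range fun i => toReal (v i)) := by
  apply le_antisymm
  · rw [Submodule.span_le]
    rintro _ ⟨i, rfl⟩
    exact (b i).2
  · rw [Submodule.span_le]
    rintro _ ⟨i, rfl⟩
    have hi : v i ∈ integerPoints (Submodule.span ℝ (Set.range fun i => toReal (v i))) :=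
      Submodule.subset_span ⟨i, rfl⟩
    change toReal (v i) ∈ _
    rw [← sum_repr_smul_toReal b (⟨v i, hi⟩ : integerPoints _)]
    exact Submodule.sum_mem _ fun j _ =>
      Submodule.smul_mem _ _ (Submodule.subset_span ⟨j, rfl⟩)

lemma finrank_integerPoints_span {m : ℕ} {κ : Type*} (v : κ → Fin m → ℤ) :
    Module.finrank ℤ (integerPoints (Submodule.span ℝ (Set.range fun i => toReal (v i)))) =
      Module.finrank ℝ (Submodule.span ℝ (Set.range fun i => toReal (v i))) := by
  let b := Module.finBasis ℤ (integerPoints (Submodule.span ℝ (Set.range fun i => toReal (v i))))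
  have h := finrank_span_eq_card (linearIndependent_toReal_basis b)
  rw [span_toReal_basis_integerPoints v b] at h
  rw [h, Fintype.card_fin]

lemma exists_basis_eq_mul_coord {R L : Type*} [CommRing R] [IsDomain R] [IsPrincipalIdealRing R]
    [AddCommGroup L] [Module R L] [Module.Free R L] [Module.Finite R L] (f : L →ₗ[R] R) {d : R}
    (hf : LinearMap.range f = Ideal.span {d}) {k : ℕ} (hk : 0 < k)
    (hrank : Module.finrank R L = k) :
    ∃ b : Module.Basis (Fin k) R L, ∀ z, f z = d * b.repr z ⟨0, hk⟩ := by
  by_cases hd : d = 0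
  · have hf0 : f = 0 := by
      rw [← LinearMap.range_eq_bot, hf, hd]
      simp
    exact ⟨Module.finBasisOfFinrankEq R L hrank, fun z => by simp [hf0, hd]⟩
  · obtain ⟨u, hu⟩ : d ∈ LinearMap.range f := hf ▸ Ideal.mem_span_singleton_self d
    let b := Module.Basis.mkFinCons u (Module.finBasis R (LinearMap.ker f))
      (fun c x hx hcx => by
        have h := congrArg f hcx
        rw [map_add, map_smul, LinearMap.mem_ker.1 hx, hu] at h
        simpa [hd] using h)
      (fun z => by
        have hz : f z ∈ Ideal.span {d} := hf ▸ LinearMap.mem_range_self f z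
        obtain ⟨c, hc⟩ := Ideal.mem_span_singleton'.1 hz
        exact ⟨-c, by simp [hu, hc]⟩)
    obtain rfl : Module.finrank R (LinearMap.ker f) + 1 = k := by
      rw [← hrank, Module.finrank_eq_card_basis b, Fintype.card_fin]
    have hb : f = d • b.coord 0 := by
      refine b.ext fun i => ?_
      have hcoe : ⇑b = Fin.cons u ((↑) ∘ Module.finBasis R (LinearMap.ker f)) :=
        Module.Basis.coe_mkFinCons ..
      simp only [LinearMap.smul_apply, Module.Basis.coord_apply, Module.Basis.repr_self]
      rw [hcoe]
      refine Fin.cases ?_ (fun j => ?_) i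
      · simp [hu]
      · simp
    exact ⟨b, fun z => LinearMap.congr_fun hb z⟩

lemma map_mem_coneGen_iff {m n l : ℕ} (T : (Fin n → ℝ) →ₗ[ℝ] (Fin m → ℝ))
    (hT : Function.Injective T) (w : Fin l → Fin n → ℝ) (x : Fin n → ℝ) :
    T x ∈ coneGen (fun i => T (w i)) ↔ x ∈ coneGen w := by
  simp only [coneGen, Set.mem_ofPred_eq, ← map_smul, ← map_sum, hT.eq_iff]

lemma coneGen_subset_span {m l : ℕ} (v : Fin l → Fin m → ℝ) :
    coneGen v ⊆ Submodule.span ℝ (Set.range v) := by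
  rintro _ ⟨c, -, rfl⟩
  exact Submodule.sum_mem _ fun i _ => Submodule.smul_mem _ _ (Submodule.subset_span ⟨i, rfl⟩)

/-- Every integer point of the span of a rational cone is a difference of two integer points of
the cone. -/
lemma exists_add_mem_coneGen {m l : ℕ} (v : Fin l → Fin m → ℤ) {z : Fin m → ℤ}
    (hz : toReal z ∈ Submodule.span ℝ (Set.range fun i => toReal (v i))) :
    ∃ y : Fin m → ℤ, toReal y ∈ coneGen (fun i => toReal (v i)) ∧
      toReal (z + y) ∈ coneGen (fun i => toReal (v i)) := by
  obtain ⟨c, hc⟩ := (Submodule.mem_span_range_iff_exists_fun ℝ).1 hz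
  have hy : toReal (∑ i, (⌈|c i|⌉ : ℤ) • v i) = ∑ i, (⌈|c i|⌉ : ℝ) • toReal (v i) := by
    simp_rw [← toRealLinearMap_apply, map_sum, map_smul, Int.cast_smul_eq_zsmul]
  refine ⟨∑ i, ⌈|c i|⌉ • v i, ⟨fun i => ⌈|c i|⌉, fun i => ?_, hy⟩,
    ⟨fun i => c i + ⌈|c i|⌉, fun i => ?_, ?_⟩⟩
  · exact Int.cast_nonneg (Int.ceil_nonneg (abs_nonneg (c i)))
  · linarith [Int.le_ceil |c i|, neg_abs_le (c i)]
  · rw [← toRealLinearMap_apply, map_add, toRealLinearMap_apply, toRealLinearMap_apply, hy, ← hc,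
      ← Finset.sum_add_distrib]
    simp only [add_smul]

/-- if `S` is `k`-normalescent and `gcd(S) = d`, then `S = π(C ∩ ℤ^k)` for a
full-dimensional rational polyhedral cone `C ⊆ ℝ^k`, with `π(x) = d·x₁`. -/
theorem normalescent_first_coordinate (k : ℕ) (hk : 0 < k) (S : Set ℕ)
    (hS : IsNumericalSemigroup S) (d : ℕ)
    (hdvd : ∀ s ∈ S, d ∣ s) (hgcd : ∀ e : ℕ, (∀ s ∈ S, e ∣ s) → e ∣ d)
    (h : IsKNormalescent k S) :
    ∃ (l : ℕ) (v : Fin l → (Fin k → ℤ)),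
      Module.finrank ℝ (Submodule.span ℝ (Set.range (fun i => toReal (v i)))) = k ∧
      {t : ℤ | ∃ z : Fin k → ℤ, toReal z ∈ coneGen (fun i => toReal (v i)) ∧
          t = (d : ℤ) * z ⟨0, hk⟩} = (fun n : ℕ => (n : ℤ)) '' S := by
  obtain ⟨m, l, v, p, hv, -, hS'⟩ := h
  set W := Submodule.span ℝ (Set.range fun i => toReal (v i))
  let f : integerPoints W →ₗ[ℤ] ℤ :=
    (Fintype.linearCombination ℤ p) ∘ₗ (integerPoints W).subtype
  have hf (z : integerPoints W) : f z = ∑ j, p j * (z : Fin m → ℤ) j := by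
    simp [f, Fintype.linearCombination_apply, mul_comm]
  have hcone {z : Fin m → ℤ} (hz : toReal z ∈ coneGen fun i => toReal (v i)) :
      z ∈ integerPoints W := coneGen_subset_span _ hz
  have hfS {z : integerPoints W} (hz : toReal (z : Fin m → ℤ) ∈ coneGen fun i => toReal (v i)) :
      ∃ n ∈ S, (n : ℤ) = f z := hS'.subset ⟨z, hz, hf z⟩
  have hrange : LinearMap.range f = Ideal.span {(d : ℤ)} := by
    apply le_antisymm
    · rintro _ ⟨z, rfl⟩
      obtain ⟨y, hy, hzy⟩ := exists_add_mem_coneGen v z.2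
      obtain ⟨s, hs, hsy⟩ := hfS (z := ⟨y, hcone hy⟩) hy
      obtain ⟨t, ht, hty⟩ := hfS (z := z + ⟨y, hcone hy⟩) hzy
      have h : f z = t - s := by rw [hsy, hty, map_add, add_sub_cancel_right]
      rw [h, Ideal.mem_span_singleton]
      exact dvd_sub (Int.natCast_dvd_natCast.2 (hdvd t ht)) (Int.natCast_dvd_natCast.2 (hdvd s hs))
    · obtain ⟨g, hg⟩ := (IsPrincipalIdealRing.principal (LinearMap.range f)).principal
      rw [hg, Ideal.submodule_span_eq, Ideal.span_singleton_le_span_singleton,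
        ← Int.natAbs_dvd, Int.natCast_dvd_natCast]
      refine hgcd _ fun s hs => ?_
      obtain ⟨z, hz, hsz⟩ := hS'.superset (Set.mem_image_of_mem _ hs)
      have h : (s : ℤ) ∈ LinearMap.range f := ⟨⟨z, hcone hz⟩, by rw [hf]; exact hsz.symm⟩
      rw [hg, Ideal.submodule_span_eq, Ideal.mem_span_singleton, ← Int.natAbs_dvd] at h
      exact Int.natCast_dvd_natCast.1 h
  obtain ⟨b, hb⟩ := exists_basis_eq_mul_coord f hrange hk
    ((finrank_integerPoints_span v).trans hv)
  let T := Fintype.linearCombination ℝ (fun j => toReal (b j : Fin m → ℤ))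
  have hT : Function.Injective T :=
    (linearIndependent_toReal_basis b).fintypeLinearCombination_injective
  have hTrepr (z : integerPoints W) : T (toReal (b.repr z)) = toReal (z : Fin m → ℤ) :=
    sum_repr_smul_toReal b z
  let w (i : Fin l) : Fin k → ℤ := b.repr ⟨v i, Submodule.subset_span ⟨i, rfl⟩⟩
  have hTw (i : Fin l) : T (toReal (w i)) = toReal (v i) := hTrepr _
  have hmem (z : integerPoints W) : toReal (b.repr z) ∈ coneGen (fun i => toReal (w i)) ↔
      toReal (z : Fin m → ℤ) ∈ coneGen (fun i => toReal (v i)) := by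
    rw [← map_mem_coneGen_iff T hT, hTrepr]
    simp only [hTw]
  refine ⟨l, w, ?_, ?_⟩
  · rw [(Submodule.equivMapOfInjective T hT _).finrank_eq, Submodule.map_span, ← Set.range_comp,
      show (T ∘ fun i => toReal (w i)) = fun i => toReal (v i) from funext hTw]
    exact hv
  · rw [← hS']
    ext t
    constructor
    · rintro ⟨z, hz, rfl⟩
      obtain ⟨y, rfl⟩ := b.equivFun.surjective z
      exact ⟨y, (hmem y).1 hz, by rw [← hf, hb]; rfl⟩
    · rintro ⟨z, hz, rfl⟩
      exact ⟨b.repr ⟨z, hcone hz⟩, (hmem ⟨z, hcone hz⟩).2 hz, by rw [← hb, hf]⟩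
end

section
/- If a numerical semigroup S is k-ray-normalescent and gcd(S) = d, then there exist k linearly independent integer vectors v₁,…,v_k ∈ ℤ^k such that S = π(C ∩ ℤ^k), where C ⊆ ℝ^k is the simplicial cone generated by v₁,…,v_k and π : ℝ^k → ℝ is the map π(x) = d·x₁ (d times the first coordinate). -/
open scoped BigOperators

/-- Finitely many positive reals can be sent to positive rationals by a `ℚ`-linear functional. -/
lemma exists_rat_linearMap_pos {ι : Type*} [Finite ι] (x : ι → ℝ) (hx : ∀ i, 0 < x i) :
    ∃ φ : ℝ →ₗ[ℚ] ℚ, ∀ i, 0 < φ (x i) := by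
  classical
  let b := Module.Basis.ofVectorSpace ℚ ℝ
  obtain ⟨ε, hε, hεx⟩ : ∃ ε : ℝ, 0 < ε ∧
      ∀ i, ε * ∑ j ∈ (b.repr (x i)).support, |(b.repr (x i) j : ℝ)| < x i := by
    have hev : ∀ᶠ ε : ℝ in nhdsWithin 0 (Set.Ioi 0),
        ∀ i, ε * ∑ j ∈ (b.repr (x i)).support, |(b.repr (x i) j : ℝ)| < x i := by
      rw [Filter.eventually_all]
      intro i
      refine Filter.Eventually.filter_mono nhdsWithin_le_nhds ?_
      have hc : Continuous fun ε : ℝ =>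
        ε * ∑ j ∈ (b.repr (x i)).support, |(b.repr (x i) j : ℝ)| := by fun_prop
      exact hc.continuousAt.eventually_lt continuousAt_const (by simpa using hx i)
    obtain ⟨ε, h₁, h₂⟩ := (hev.and self_mem_nhdsWithin).exists
    exact ⟨ε, h₂, h₁⟩
  choose q hq using fun j => exists_rat_near (b j) hε
  refine ⟨b.constr ℚ q, fun i => ?_⟩
  have hφ : ((b.constr ℚ q (x i) : ℚ) : ℝ)
      = ∑ j ∈ (b.repr (x i)).support, (b.repr (x i) j : ℝ) * q j := by
    rw [Module.Basis.constr_apply, Finsupp.sum]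
    push_cast [smul_eq_mul]
    rfl
  have hxi : x i = ∑ j ∈ (b.repr (x i)).support, (b.repr (x i) j : ℝ) * b j := by
    conv_lhs => rw [← b.linearCombination_repr (x i), Finsupp.linearCombination_apply, Finsupp.sum]
    simp only [Rat.smul_def]
  have hdiff : x i - ((b.constr ℚ q (x i) : ℚ) : ℝ)
      ≤ ε * ∑ j ∈ (b.repr (x i)).support, |(b.repr (x i) j : ℝ)| := by
    rw [congrArg₂ (· - ·) hxi hφ, ← Finset.sum_sub_distrib, Finset.mul_sum]
    refine Finset.sum_le_sum fun j _ => ?_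
    rw [← mul_sub]
    refine (le_abs_self _).trans ?_
    rw [abs_mul, mul_comm]
    exact mul_le_mul_of_nonneg_right (hq j).le (abs_nonneg _)
  have hlt := hεx i
  have : (0 : ℝ) < ((b.constr ℚ q (x i) : ℚ) : ℝ) := by linarith
  exact_mod_cast this

/-- A system of linear equations with integer coefficients that has a nonnegative real solution
has a nonnegative rational one. -/
lemma exists_rat_nonneg_solution {ι κ : Type*} [Fintype ι] (A : ι → κ → ℤ) (y : κ → ℤ)
    (c : ι → ℝ) (hc : ∀ i, 0 ≤ c i) (hcy : ∀ l, ∑ i, c i * A i l = y l) :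
    ∃ r : ι → ℚ, (∀ i, 0 ≤ r i) ∧ ∀ l, ∑ i, r i * A i l = y l := by
  classical
  obtain ⟨φ, hφ⟩ := exists_rat_linearMap_pos
    (fun o : Option {i // 0 < c i} => o.elim 1 fun i => c i)
    (by rintro (_ | ⟨i, hi⟩) <;> simp_all)
  have h1 : 0 < φ 1 := hφ none
  refine ⟨fun i => φ (c i) / φ 1, fun i => ?_, fun l => ?_⟩
  · rcases (hc i).eq_or_lt with h | h
    · simp [← h]
    · exact (div_pos (hφ (some ⟨i, h⟩)) h1).le
  · have h := congrArg φ (hcy l)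
    have hmul : ∀ (a : ℝ) (n : ℤ), φ (a * n) = φ a * n := fun a n => by
      have := φ.map_smul (n : ℚ) a
      simpa [Rat.smul_def, mul_comm] using this
    have hy : φ (y l : ℝ) = φ 1 * y l := by simpa using hmul 1 (y l)
    simp only [map_sum, hmul, hy] at h
    rw [eq_comm, ← mul_right_inj' h1.ne', ← h, Finset.mul_sum]
    refine Finset.sum_congr rfl fun i _ => ?_
    field_simp

/-- A surjective functional on a finite free module is the first coordinate in some basis. -/
lemma exists_basis_first_coordinate {R M : Type*} [CommRing R] [IsDomain R]
    [IsPrincipalIdealRing R] [AddCommGroup M] [Module R M] [Module.Free R M] [Module.Finite R M]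
    {n : ℕ} (hn : Module.finrank R M = n + 1) (f : M →ₗ[R] R) (hf : Function.Surjective f) :
    ∃ b : Module.Basis (Fin (n + 1)) R M, f (b 0) = 1 ∧ ∀ j : Fin n, f (b j.succ) = 0 := by
  obtain ⟨y, hy⟩ := hf 1
  obtain ⟨r, b⟩ := (LinearMap.ker f).basisOfPid (Module.finBasis R M)
  let B := Module.Basis.mkFinCons y b
    (fun c x hx h => by simpa [hy, LinearMap.mem_ker.1 hx] using congrArg f h)
    (fun z => ⟨-f z, by simp [hy]⟩)
  obtain rfl : r = n := by
    have := Module.finrank_eq_card_basis B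
    simp only [Fintype.card_fin] at this
    omega
  exact ⟨B, by simp [B, hy], fun j => by simp [B]⟩

/-- In a full lattice in `ℚ ^ (n + 1)` containing the standard lattice, a functional with values in
`d ℤ` that attains `d` is `d` times the first coordinate with respect to some basis, the rows
of `B`. The rows of `U` are the coordinates of the standard vectors. -/
lemma exists_adapted_matrices {n : ℕ} (L : Submodule ℤ (Fin (n + 1) → ℚ)) (hfg : L.FG)
    (hL : ∀ i, Pi.single i 1 ∈ L) (w : (Fin (n + 1) → ℚ) →ₗ[ℤ] ℚ) {d : ℕ} (hd : d ≠ 0)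
    (hw : ∀ x ∈ L, ∃ a : ℤ, w x = d * a) (hwd : ∃ x ∈ L, w x = d) :
    ∃ (U : Matrix (Fin (n + 1)) (Fin (n + 1)) ℤ) (B : Matrix (Fin (n + 1)) (Fin (n + 1)) ℚ),
      U.map (Int.cast : ℤ → ℚ) * B = 1 ∧ (∀ j, B j ∈ L) ∧
      (∀ x ∈ L, ∃ z : Fin (n + 1) → ℤ, x = ∑ j, z j • B j) ∧
      ∀ z : Fin (n + 1) → ℤ, w (∑ j, z j • B j) = d * z 0 := by
  have hd' : (d : ℚ) ≠ 0 := by exact_mod_cast hd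
  have hlat : Submodule.IsLattice ℚ L := by
    refine ⟨hfg, eq_top_iff.2 ?_⟩
    rw [← (Pi.basisFun ℚ (Fin (n + 1))).span_eq]
    refine Submodule.span_mono ?_
    rintro _ ⟨i, rfl⟩
    simpa using hL i
  choose a ha using fun x : L => hw x x.2
  let f : L →ₗ[ℤ] ℤ := (AddMonoidHom.mk' a fun x y => by
    have h := ha (x + y)
    rw [Submodule.coe_add, map_add, ha, ha, ← mul_add] at h
    exact_mod_cast (mul_left_cancel₀ hd' h).symm).toIntLinearMap
  have hf : Function.Surjective f := by
    obtain ⟨x, hx, hxd⟩ := hwd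
    have h1 : a ⟨x, hx⟩ = 1 := by
      have h := ha ⟨x, hx⟩
      rw [hxd] at h
      have : (d : ℚ) * a ⟨x, hx⟩ = d * 1 := by rw [← h, mul_one]
      exact_mod_cast mul_left_cancel₀ hd' this
    intro t
    refine ⟨t • ⟨x, hx⟩, ?_⟩
    rw [map_smul]
    change t • a ⟨x, hx⟩ = t
    simp [h1]
  have hfree : Module.Free ℤ L := Submodule.IsLattice.free ℚ L
  have hfin : Module.Finite ℤ L := Module.Finite.iff_fg.2 hfg
  obtain ⟨b, hb0, hbs⟩ := exists_basis_first_coordinate (n := n)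
    (by simpa using Submodule.IsLattice.finrank_of_pi ℚ L) f hf
  have hsum : ∀ x : L, (x : Fin (n + 1) → ℚ) = ∑ j, b.repr x j • (b j : Fin (n + 1) → ℚ) := by
    intro x
    conv_lhs => rw [← b.sum_repr x]
    simp only [Submodule.coe_sum, Submodule.coe_smul]
  refine ⟨Matrix.of fun i j => b.repr ⟨_, hL i⟩ j, Matrix.of fun j => (b j : Fin (n + 1) → ℚ),
    ?_, fun j => (b j).2, fun x hx => ⟨fun j => b.repr ⟨x, hx⟩ j, hsum ⟨x, hx⟩⟩, fun z => ?_⟩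
  · ext i l
    have h := congrFun (hsum ⟨_, hL i⟩) l
    simpa [Matrix.mul_apply, Matrix.one_apply, Pi.single_apply, eq_comm] using h.symm
  · have h0 : w (b 0) = d := by
      rw [ha, show a (b 0) = 1 from hb0, Int.cast_one, mul_one]
    have hsucc : ∀ j : Fin n, w (b j.succ) = 0 := fun j => by
      rw [ha, show a (b j.succ) = 0 from hbs j, Int.cast_zero, mul_zero]
    change w (∑ j, z j • (b j : Fin (n + 1) → ℚ)) = _
    rw [map_sum, Fin.sum_univ_succ]
    simp only [map_smul, h0, hsucc, smul_zero, Finset.sum_const_zero, add_zero]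
    rw [zsmul_eq_mul, mul_comm]

/-- The elements of a `k`-ray-normalescent semigroup are the values of a functional at the
nonnegative points of a full lattice in `ℚ ^ k`. -/
lemma IsKRayNormalescent.exists_lattice {k : ℕ} {S : Set ℕ} (hS : IsNumericalSemigroup S)
    (h : IsKRayNormalescent k S) :
    ∃ (L : Submodule ℤ (Fin k → ℚ)) (w : (Fin k → ℚ) →ₗ[ℤ] ℚ), L.FG ∧
      (∀ i, Pi.single i 1 ∈ L) ∧
      (∀ x ∈ L, (∀ i, 0 ≤ x i) → ∃ s ∈ S, w x = (s : ℚ)) ∧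
      (∀ s ∈ S, ∃ x ∈ L, (∀ i, 0 ≤ x i) ∧ w x = (s : ℚ)) ∧
      ∀ d : ℕ, (∀ s ∈ S, d ∣ s) → ∀ x ∈ L, ∃ a : ℤ, w x = d * a := by
  classical
  obtain ⟨m, v, p, -, hπ⟩ := h
  -- Rational points of the cone with integral image.
  let w : (Fin k → ℚ) →ₗ[ℤ] ℚ := (Fintype.linearCombination ℚ
    fun i => ((∑ l, p l * v i l : ℤ) : ℚ)).restrictScalars ℤ
  have hw : ∀ x, w x = ∑ i, x i * ((∑ l, p l * v i l : ℤ) : ℚ) := fun x => by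
    simp [w, Fintype.linearCombination_apply]
  have hwy : ∀ (x : Fin k → ℚ) (y : Fin m → ℤ), (∀ l, ∑ i, x i * v i l = y l) →
      w x = ((∑ l, p l * y l : ℤ) : ℚ) := by
    intro x y hxy
    rw [hw]
    push_cast
    simp only [← hxy, Finset.mul_sum]
    rw [Finset.sum_comm]
    exact Finset.sum_congr rfl fun _ _ => Finset.sum_congr rfl fun _ _ => by ring
  have hmem : ∀ (x : Fin k → ℚ) (y : Fin m → ℤ), (∀ i, 0 ≤ x i) →
      (∀ l, ∑ i, x i * v i l = y l) → ∃ s ∈ S, w x = (s : ℚ) := by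
    intro x y hx hxy
    obtain ⟨s, hs, hsy⟩ : ∑ l, p l * y l ∈ (fun n : ℕ => (n : ℤ)) '' S := by
      rw [← hπ]
      refine ⟨y, ⟨fun i => x i, fun i => Rat.cast_nonneg.2 (hx i), ?_⟩, rfl⟩
      ext l
      simp only [toReal, Finset.sum_apply, Pi.smul_apply, smul_eq_mul]
      exact_mod_cast (hxy l).symm
    refine ⟨s, hs, ?_⟩
    rw [hwy x y hxy, ← hsy]
    simp
  have hlift : ∀ s : S, ∃ x : Fin k → ℚ, (∀ i, 0 ≤ x i) ∧
      (∃ y : Fin m → ℤ, ∀ l, ∑ i, x i * v i l = y l) ∧ w x = (s : ℕ) := by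
    rintro ⟨s, hs⟩
    obtain ⟨y, ⟨c, hc, hcy⟩, hsy⟩ := hπ.symm ▸ Set.mem_image_of_mem (fun n : ℕ => (n : ℤ)) hs
    obtain ⟨x, hx, hxy⟩ := exists_rat_nonneg_solution (fun i l => v i l) y c hc fun l => by
      simpa [toReal] using (congrFun hcy l).symm
    refine ⟨x, hx, ⟨y, hxy⟩, ?_⟩
    rw [hwy x y hxy, ← hsy]
    simp
  choose g hg0 hgy hgw using hlift
  let T : AddSubmonoid ℕ := ⟨⟨S, fun {a b} ha hb => hS.2 a ha b hb⟩, hS.1⟩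
  obtain ⟨F, hF⟩ := Nat.addSubmonoid_fg T
  have hFS : (F : Set ℕ) ⊆ S := fun s hs => by
    have : s ∈ T := hF ▸ AddSubmonoid.subset_closure hs
    exact this
  let G : Set (Fin k → ℚ) := Set.range (fun i => Pi.single i 1) ∪
    Set.range fun s : F => g ⟨s, hFS s.2⟩
  have hG : ∀ x ∈ G, (∀ i, 0 ≤ x i) ∧ ∃ y : Fin m → ℤ, ∀ l, ∑ i, x i * v i l = y l := by
    rintro _ (⟨i, rfl⟩ | ⟨s, rfl⟩)
    · refine ⟨fun j => ?_, v i, fun l => by simp [Pi.single_apply]⟩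
      by_cases hij : j = i <;> simp [hij]
    · exact ⟨hg0 _, hgy _⟩
  have hint : ∀ x ∈ Submodule.span ℤ G, ∃ y : Fin m → ℤ, ∀ l, ∑ i, x i * v i l = y l := by
    intro x hx
    induction hx using Submodule.span_induction with
    | mem x hx => exact (hG x hx).2
    | zero => exact ⟨0, by simp⟩
    | add x x' _ _ h h' =>
      obtain ⟨y, hy⟩ := h
      obtain ⟨y', hy'⟩ := h'
      exact ⟨y + y', fun l => by simp [add_mul, Finset.sum_add_distrib, hy, hy']⟩
    | smul t x _ h =>
      obtain ⟨y, hy⟩ := h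
      exact ⟨t • y, fun l => by simp [mul_assoc, ← Finset.mul_sum, hy]⟩
  refine ⟨Submodule.span ℤ G, w, Submodule.fg_span ((Set.finite_range _).union
    (Set.finite_range _)), fun i => Submodule.subset_span (Or.inl ⟨i, rfl⟩), ?_, ?_, ?_⟩
  · intro x hx hx0
    obtain ⟨y, hy⟩ := hint x hx
    exact hmem x y hx0 hy
  · intro s hs
    have hsT : s ∈ AddSubmonoid.closure (F : Set ℕ) := hF ▸ hs
    clear hs
    induction hsT using AddSubmonoid.closure_induction with
    | mem s hs =>
      exact ⟨g ⟨s, hFS hs⟩, Submodule.subset_span (Or.inr ⟨⟨s, hs⟩, rfl⟩), hg0 _, hgw _⟩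
    | zero => exact ⟨0, zero_mem _, by simp⟩
    | add s s' _ _ h h' =>
      obtain ⟨x, hx, hx0, hxs⟩ := h
      obtain ⟨x', hx', hx0', hxs'⟩ := h'
      exact ⟨x + x', add_mem hx hx', fun i => add_nonneg (hx0 i) (hx0' i), by simp [hxs, hxs']⟩
  · intro d hd x hx
    induction hx using Submodule.span_induction with
    | mem x hx =>
      obtain ⟨hx0, y, hy⟩ := hG x hx
      obtain ⟨s, hs, hxs⟩ := hmem x y hx0 hy
      obtain ⟨a, rfl⟩ := hd s hs
      exact ⟨a, by simp [hxs]⟩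
    | zero => exact ⟨0, by simp⟩
    | add x x' _ _ h h' =>
      obtain ⟨a, ha⟩ := h
      obtain ⟨a', ha'⟩ := h'
      exact ⟨a + a', by simp [ha, ha', mul_add]⟩
    | smul t x _ h =>
      obtain ⟨a, ha⟩ := h
      exact ⟨t * a, by rw [map_smul, ha, zsmul_eq_mul]; push_cast; ring⟩

/-- if `S` is `k`-ray-normalescent and `gcd(S) = d`, then `S = π(C ∩ ℤ^k)` for a
simplicial cone `C ⊆ ℝ^k` generated by `k` linearly independent integer vectors, with
`π(x) = d·x₁`. -/
theorem rayNormalescent_simplicial_first_coordinate (k : ℕ) (hk : 0 < k) (S : Set ℕ)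
    (hS : IsNumericalSemigroup S) (d : ℕ)
    (hdvd : ∀ s ∈ S, d ∣ s) (hgcd : ∀ e : ℕ, (∀ s ∈ S, e ∣ s) → e ∣ d)
    (h : IsKRayNormalescent k S) :
    ∃ v : Fin k → (Fin k → ℤ),
      LinearIndependent ℝ (fun i => toReal (v i)) ∧
      {t : ℤ | ∃ z : Fin k → ℤ, toReal z ∈ coneGen (fun i => toReal (v i)) ∧
          t = (d : ℤ) * z ⟨0, hk⟩} = (fun n : ℕ => (n : ℤ)) '' S := by
  classical
  rcases eq_or_ne d 0 with rfl | hd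
  · refine ⟨fun i => Pi.single i 1, ?_, ?_⟩
    · convert (Pi.basisFun ℝ (Fin k)).linearIndependent using 2 with i
      ext j
      simp [toReal, Pi.single_apply]
    · ext t
      constructor
      · rintro ⟨z, -, rfl⟩
        exact ⟨0, hS.1, by simp⟩
      · rintro ⟨s, hs, rfl⟩
        refine ⟨0, ⟨0, by simp, ?_⟩, by simpa using hdvd s hs⟩
        ext j
        simp [toReal]
  obtain ⟨n, rfl⟩ : ∃ n, k = n + 1 := ⟨k - 1, by omega⟩
  obtain ⟨L, w, hfg, hL, hLS, hSL, hLd⟩ := h.exists_lattice hS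
  have hwd : ∃ x ∈ L, w x = d := by
    let H : AddSubgroup ℤ := (L.map w).toAddSubgroup.comap (Int.castAddHom ℚ)
    obtain ⟨e, he⟩ := Int.subgroup_cyclic H
    have hmemH : ∀ t : ℤ, t ∈ H ↔ e ∣ t := fun t => by
      rw [he, ← AddSubgroup.zmultiples_eq_closure, Int.mem_zmultiples_iff]
    have hed : e.natAbs ∣ d := hgcd _ fun s hs => by
      obtain ⟨x, hx, -, hxs⟩ := hSL s hs
      exact Int.natAbs_dvd_natAbs.2 ((hmemH s).1 ⟨x, hx, by simpa using hxs⟩)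
    obtain ⟨x, hx, hxd⟩ := (hmemH d).2 (Int.natAbs_dvd_natAbs.1 hed)
    exact ⟨x, hx, by simpa using hxd⟩
  obtain ⟨U, B, hUB, hB, hspan, hwB⟩ := exists_adapted_matrices L hfg hL w hd (hLd d hdvd) hwd
  have hU : U.map (Int.cast : ℤ → ℝ) * B.map (Rat.cast : ℚ → ℝ) = 1 := by
    have := congrArg (fun A => A.map (Rat.castHom ℝ)) hUB
    rw [Matrix.map_mul, Matrix.map_one _ (map_zero _) (map_one _)] at this
    rw [← this]
    congr 1
  have hcomb : ∀ (c : Fin (n + 1) → ℝ),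
      ∑ i, c i • toReal (U i) = Matrix.vecMul c (U.map (Int.cast : ℤ → ℝ)) := fun c => by
    ext j
    simp [Matrix.vecMul, dotProduct, toReal]
  have hcast : ∀ (z : Fin (n + 1) → ℤ), (fun i => (((∑ j, z j • B j) i : ℚ) : ℝ))
      = Matrix.vecMul (toReal z) (B.map (Rat.cast : ℚ → ℝ)) := fun z => by
    ext i
    simp [Matrix.vecMul, dotProduct, toReal]
  refine ⟨U, ?_, ?_⟩
  · exact Matrix.linearIndependent_rows_of_isUnit (A := U.map (Int.cast : ℤ → ℝ))
      (IsUnit.of_mul_eq_one _ hU)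
  · ext t
    constructor
    · rintro ⟨z, ⟨c, hc, hz⟩, rfl⟩
      have hx : ∀ i, (((∑ j, z j • B j) i : ℚ) : ℝ) = c i := congrFun <| by
        rw [hcast, hz, hcomb, Matrix.vecMul_vecMul, hU, Matrix.vecMul_one]
      obtain ⟨s, hs, hxs⟩ := hLS (∑ j, z j • B j)
        (sum_mem fun j _ => L.smul_mem _ (hB j)) fun i => by
          have := hc i
          rw [← hx i] at this
          exact_mod_cast this
      rw [hwB] at hxs
      exact ⟨s, hs, by exact_mod_cast hxs.symm⟩
    · rintro ⟨s, hs, rfl⟩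
      obtain ⟨x, hxL, hx0, hxs⟩ := hSL s hs
      obtain ⟨z, rfl⟩ := hspan x hxL
      refine ⟨z, ⟨fun i => (((∑ j, z j • B j) i : ℚ) : ℝ), fun i =>
        Rat.cast_nonneg.2 (hx0 i), ?_⟩, ?_⟩
      · rw [hcomb, hcast, Matrix.vecMul_vecMul, mul_eq_one_comm.1 hU, Matrix.vecMul_one]
      · rw [hwB] at hxs
        exact_mod_cast hxs.symm
end

section
/- Let M ∈ ℤ^{k×k} be a full-rank integer matrix whose first row (a₁,…,a_k) consists of positive integers. If gcd(a₁,…,a_k) = 1 and the Smith Normal Form of M has diagonal (1, d, d, …, d) for some positive integer d, then s(M) = ⟨a₁,…,a_k⟩/d; in particular s(M) is a k-quotient. -/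
open scoped BigOperators

open Matrix in
/-- A matrix with Smith normal form `(1, d, …, d)` divides `d` times the identity. -/
theorem exists_mul_eq_smul_one_of_snf {n : Type*} [Fintype n] [DecidableEq n] {i₀ : n}
    {M U V : Matrix n n ℤ} {d : ℤ} (hU : IsUnit U.det) (hV : IsUnit V.det)
    (h : M = U * diagonal (fun i => if i = i₀ then 1 else d) * V) :
    ∃ N : Matrix n n ℤ, N * M = d • (1 : Matrix n n ℤ) := by
  refine ⟨V⁻¹ * diagonal (fun i => if i = i₀ then d else 1) * U⁻¹, ?_⟩
  have hD : diagonal (fun i => if i = i₀ then d else 1) *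
      diagonal (fun i => if i = i₀ then 1 else d) = d • (1 : Matrix n n ℤ) := by
    rw [diagonal_mul_diagonal, smul_one_eq_diagonal]
    congr 1
    ext i
    split_ifs <;> simp
  calc V⁻¹ * diagonal (fun i => if i = i₀ then d else 1) * U⁻¹ * M
      = V⁻¹ * (diagonal (fun i => if i = i₀ then d else 1) * ((U⁻¹ * U) *
          diagonal (fun i => if i = i₀ then 1 else d))) * V := by
        rw [h]; simp only [Matrix.mul_assoc]
    _ = d • (1 : Matrix n n ℤ) := by
        rw [nonsing_inv_mul _ hU, Matrix.one_mul, hD, Matrix.mul_smul, Matrix.mul_one,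
          Matrix.smul_mul, nonsing_inv_mul _ hV]

/-- Modulo `d`, a matrix with Smith normal form `(1, d, …, d)` is an outer product. -/
theorem dvd_sub_of_snf {n : Type*} [Fintype n] [DecidableEq n] {i₀ : n}
    {M U V : Matrix n n ℤ} {d : ℤ}
    (h : M = U * Matrix.diagonal (fun i => if i = i₀ then 1 else d) * V) (r j : n) :
    d ∣ M r j - U r i₀ * V i₀ j := by
  rw [h, Matrix.mul_apply, ← Finset.add_sum_erase _ _ (Finset.mem_univ i₀)]
  simp only [Matrix.mul_diagonal, if_true, mul_one, add_sub_cancel_left]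
  refine Finset.dvd_sum fun i hi => ?_
  rw [if_neg (Finset.ne_of_mem_erase hi)]
  exact Dvd.intro_left _ (by ring : U r i * V i j * d = _)

/-- If `M` is an outer product modulo `d` and its row `i₀` is unimodular, then `d` divides `M x`
as soon as it divides the coordinate `i₀` of `M x`. -/
theorem dvd_sum_of_outer_product {n : Type*} [Fintype n] {i₀ : n} {M : Matrix n n ℤ} {d : ℤ}
    {u v : n → ℤ} (h : ∀ r j, d ∣ M r j - u r * v j)
    (hcop : ∀ e : ℤ, (∀ j, e ∣ M i₀ j) → IsUnit e) {x : n → ℤ}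
    (hx : d ∣ ∑ j, M i₀ j * x j) (r : n) : d ∣ ∑ j, M r j * x j := by
  have key : ∀ r, d ∣ ∑ j, M r j * x j - u r * ∑ j, v j * x j := fun r => by
    rw [Finset.mul_sum, ← Finset.sum_sub_distrib]
    refine Finset.dvd_sum fun j _ => ?_
    rw [← mul_assoc, ← sub_mul]
    exact (h r j).mul_right _
  have hu : IsCoprime d (u i₀) := by
    rw [← gcd_isUnit_iff]
    refine hcop _ fun j => ?_
    exact (dvd_iff_dvd_of_dvd_sub ((gcd_dvd_left d (u i₀)).trans (h i₀ j))).2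
      ((gcd_dvd_right d (u i₀)).mul_right _)
  have hv : d ∣ ∑ j, v j * x j :=
    hu.dvd_of_dvd_mul_left ((dvd_iff_dvd_of_dvd_sub (key i₀)).1 hx)
  exact (dvd_iff_dvd_of_dvd_sub (key r)).2 (hv.mul_left _)

/-- Membership of an integer vector in the cone over the columns of `M`, coordinatewise. -/
theorem toReal_mem_coneGen_iff {m l : ℕ} (M : Matrix (Fin m) (Fin l) ℤ) (z : Fin m → ℤ) :
    toReal z ∈ coneGen (fun i => toReal (fun r => M r i)) ↔
      ∃ c : Fin l → ℝ, (∀ i, 0 ≤ c i) ∧ ∀ r, (z r : ℝ) = ∑ i, (M r i : ℝ) * c i := by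
  simp [coneGen, toReal, funext_iff, Finset.sum_apply, mul_comm]

/-- If `M` divides `d` times the identity, then every integer vector in the cone over the columns
of `M` becomes a natural combination of the columns after multiplication by `d`. -/
theorem exists_nat_of_mem_cone {k : ℕ} {M N : Matrix (Fin k) (Fin k) ℤ} {d : ℤ} (hd : 0 < d)
    (hN : N * M = d • (1 : Matrix (Fin k) (Fin k) ℤ)) {z : Fin k → ℤ} {c : Fin k → ℝ}
    (hc : ∀ i, 0 ≤ c i) (hz : ∀ r, (z r : ℝ) = ∑ i, (M r i : ℝ) * c i) :
    ∃ x : Fin k → ℕ, ∀ r, d * z r = ∑ i, M r i * (x i : ℤ) := by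
  have hNz : ∀ i, ((∑ r, N i r * z r : ℤ) : ℝ) = d * c i := fun i => by
    have hrow : ∀ j, ∑ r, (N i r : ℝ) * M r j = if i = j then (d : ℝ) else 0 := fun j => by
      have := congrFun (congrFun hN i) j
      rw [Matrix.mul_apply, Matrix.smul_apply, Matrix.one_apply] at this
      have := congrArg (Int.cast : ℤ → ℝ) this
      push_cast at this
      simpa using this
    push_cast
    simp_rw [hz, Finset.mul_sum]
    rw [Finset.sum_comm]
    simp_rw [← mul_assoc, ← Finset.sum_mul, hrow]
    simp
  have hnn : ∀ i, 0 ≤ ∑ r, N i r * z r := fun i => by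
    have : (0 : ℝ) ≤ ((∑ r, N i r * z r : ℤ) : ℝ) := by
      rw [hNz]
      exact mul_nonneg (by exact_mod_cast hd.le) (hc i)
    exact_mod_cast this
  refine ⟨fun i => (∑ r, N i r * z r).toNat, fun r => ?_⟩
  simp_rw [Int.toNat_of_nonneg (hnn _)]
  have : ((d * z r : ℤ) : ℝ) = ((∑ i, M r i * ∑ s, N i s * z s : ℤ) : ℝ) := by
    rw [Int.cast_sum, Int.cast_mul, hz, Finset.mul_sum]
    refine Finset.sum_congr rfl fun i _ => ?_
    rw [Int.cast_mul, hNz]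
    ring
  exact_mod_cast this

/-- if `M ∈ ℤ^{k×k}` is full rank with positive, relatively prime first row
`(a₁,…,a_k)` and Smith Normal Form with diagonal `(1, d, …, d)` for a positive integer `d`,
then `s(M) = ⟨a₁,…,a_k⟩/d`; in particular `s(M)` is a `k`-quotient. -/
theorem snf_gives_quotient (k : ℕ) (hk : 0 < k) (M : Matrix (Fin k) (Fin k) ℤ)
    (hM : M.det ≠ 0) (d : ℤ) (hd : 0 < d)
    (hpos : ∀ j, 0 < M ⟨0, hk⟩ j)
    (hcoprime : ∀ e : ℤ, (∀ j, e ∣ M ⟨0, hk⟩ j) → IsUnit e)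
    (hSNF : ∃ U V : Matrix (Fin k) (Fin k) ℤ, IsUnit U.det ∧ IsUnit V.det ∧
      M = U * Matrix.diagonal (fun i => if i = ⟨0, hk⟩ then 1 else d) * V) :
    ({t : ℤ | ∃ z : Fin k → ℤ,
        toReal z ∈ coneGen (fun i => toReal (fun r => M r i)) ∧ t = z ⟨0, hk⟩}
      = {t : ℤ | 0 ≤ t ∧ ∃ x : Fin k → ℕ, d * t = ∑ i, M ⟨0, hk⟩ i * (x i : ℤ)}) ∧
    IsKQuotient k {n : ℕ | ∃ z : Fin k → ℤ,
        toReal z ∈ coneGen (fun i => toReal (fun r => M r i)) ∧ (n : ℤ) = z ⟨0, hk⟩} := by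
  obtain ⟨U, V, hU, hV, h⟩ := hSNF
  obtain ⟨N, hN⟩ := exists_mul_eq_smul_one_of_snf hU hV h
  have main : ∀ t : ℤ, (∃ z : Fin k → ℤ,
      toReal z ∈ coneGen (fun i => toReal (fun r => M r i)) ∧ t = z ⟨0, hk⟩) ↔
      0 ≤ t ∧ ∃ x : Fin k → ℕ, d * t = ∑ i, M ⟨0, hk⟩ i * (x i : ℤ) := by
    intro t
    simp_rw [toReal_mem_coneGen_iff]
    constructor
    · rintro ⟨z, ⟨c, hc, hz⟩, rfl⟩
      obtain ⟨x, hx⟩ := exists_nat_of_mem_cone hd hN hc hz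
      refine ⟨?_, x, hx _⟩
      refine nonneg_of_mul_nonneg_right ?_ hd
      rw [hx]
      exact Finset.sum_nonneg fun i _ => mul_nonneg (hpos i).le (Int.natCast_nonneg _)
    · rintro ⟨-, x, hx⟩
      choose z hz using dvd_sum_of_outer_product (dvd_sub_of_snf h) hcoprime (Dvd.intro _ hx)
      have hd' : (0 : ℝ) < d := by exact_mod_cast hd
      refine ⟨z, ⟨fun i => x i / d, fun i => by positivity, fun r => ?_⟩, ?_⟩
      · simp_rw [← mul_div_assoc, ← Finset.sum_div]
        rw [eq_div_iff hd'.ne', mul_comm]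
        exact_mod_cast (hz r).symm
      · exact mul_left_cancel₀ hd.ne' (hx.trans (hz _))
  refine ⟨Set.ext main, d.toNat, fun i => (M ⟨0, hk⟩ i).toNat, by lia,
    fun i => by have := hpos i; lia, ?_⟩
  ext n
  simp only [Set.mem_ofPred_eq, numQuot, numGen, main, Int.natCast_nonneg, true_and]
  refine exists_congr fun x => ?_
  rw [← Nat.cast_inj (R := ℤ)]
  push_cast
  simp_rw [Int.toNat_of_nonneg hd.le, Int.toNat_of_nonneg (hpos _).le]
end

section
/- Let B ∈ ℤ^{k×k} be a nonsingular integer matrix and let B' ∈ ℤ^{k×(k−1)} be B with its first column removed. Then the following two conditions hold simultaneously — (a) the Smith Normal Form of B has diagonal (1,…,1,d) for some positive integer d, and (b) the entries of the first row of adj(B) are relatively prime — if and only if the columns of B' form a primitive set, i.e., a ℤ-basis of the lattice of integer points contained in their real linear span. -/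
open scoped BigOperators

/-- Replacing a column of a matrix pairs the new column with the corresponding row of the
adjugate. -/
theorem det_updateCol_eq_sum_adjugate {R ι : Type*} [CommRing R] [Fintype ι] [DecidableEq ι]
    (A : Matrix ι ι R) (i : ι) (r : ι → R) :
    (A.updateCol i r).det = ∑ j, A.adjugate i j * r j := by
  rw [← Matrix.cramer_apply, Matrix.cramer_eq_adjugate_mulVec]
  rfl

/-- Bézout's identity for a finite family without nonunit common divisors. -/
theorem exists_sum_mul_eq_one_of_forall_dvd_isUnit {R ι : Type*} [CommRing R]
    [IsPrincipalIdealRing R] [Fintype ι] (w : ι → R)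
    (hw : ∀ e : R, (∀ j, e ∣ w j) → IsUnit e) : ∃ r : ι → R, ∑ j, w j * r j = 1 := by
  have hg := Ideal.span_singleton_generator (Ideal.span (Set.range w))
  have hu : IsUnit (Submodule.IsPrincipal.generator (Ideal.span (Set.range w))) := by
    refine hw _ fun j => ?_
    rw [← Ideal.mem_span_singleton, hg]
    exact Ideal.subset_span ⟨j, rfl⟩
  have h1 : (1 : R) ∈ Ideal.span (Set.range w) := by
    rw [← hg, Ideal.span_singleton_eq_top.mpr hu]
    trivial
  obtain ⟨c, hc⟩ := (Ideal.mem_span_range_iff_exists_fun).mp h1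
  exact ⟨c, by simpa only [mul_comm] using hc⟩

/-- Over a field, if the cofactors along the first column all vanish, then the remaining columns
are linearly dependent. -/
theorem not_linearIndependent_of_adjugate_row_eq_zero {K : Type*} [Field K] {n : ℕ}
    (A : Matrix (Fin (n + 1)) (Fin (n + 1)) K) (h : ∀ j, A.adjugate 0 j = 0) :
    ¬ LinearIndependent K (fun j : Fin n => fun i => A i j.succ) := by
  intro hli
  obtain ⟨c, hc⟩ : ∃ c, c ∉ Submodule.span K (Set.range fun j : Fin n => fun i => A i j.succ) := by
    by_contra! hall
    have htop := (Submodule.eq_top_iff').mpr hall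
    have hcard := finrank_span_eq_card hli
    rw [htop] at hcard
    simp at hcard
  have hcons := linearIndependent_finCons.mpr ⟨hli, hc⟩
  have hcol : (A.updateCol 0 c).col = Fin.cons c (fun j : Fin n => fun i => A i j.succ) := by
    funext j i
    cases j using Fin.cases <;> simp [Matrix.col]
  rw [← hcol, Matrix.linearIndependent_cols_iff_isUnit, Matrix.isUnit_iff_isUnit_det,
    det_updateCol_eq_sum_adjugate] at hcons
  simp [h] at hcons

/-- If replacing the first column of a nonsingular integer matrix `B` can make it unimodular, then
the Smith normal form of `B` has diagonal `(1, …, 1, d)`. -/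
theorem exists_smith_of_isUnit_det_updateCol {n : ℕ} (B : Matrix (Fin (n + 1)) (Fin (n + 1)) ℤ)
    (hB : B.det ≠ 0) (r : Fin (n + 1) → ℤ) (hr : IsUnit (B.updateCol 0 r).det) :
    ∃ d : ℤ, 0 < d ∧ ∃ U V : Matrix (Fin (n + 1)) (Fin (n + 1)) ℤ,
      IsUnit U.det ∧ IsUnit V.det ∧
      B = U * Matrix.diagonal (fun i => if i = Fin.last n then d else 1) * V := by
  set C := B.updateCol 0 r with hC
  set x : Fin (n + 1) → ℤ := C⁻¹.mulVec (fun i => B i 0) with hx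
  have hCx : C.mulVec x = fun i => B i 0 := by
    rw [hx, Matrix.mulVec_mulVec, Matrix.mul_nonsing_inv _ hr, Matrix.one_mulVec]
  set R : Matrix (Fin (n + 1)) (Fin (n + 1)) ℤ :=
    (1 : Matrix (Fin (n + 1)) (Fin (n + 1)) ℤ).updateCol 0 (Function.update x 0 1) with hR
  have hRdet : R.det = 1 := by
    rw [hR, det_updateCol_eq_sum_adjugate]
    simp [Matrix.adjugate_one, Matrix.one_apply]
  have hfac : B = C * Matrix.diagonal (fun i => if i = 0 then x 0 else 1) * R := by
    ext i j
    rw [Matrix.mul_apply]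
    simp only [Matrix.mul_diagonal]
    cases j using Fin.cases with
    | zero =>
      rw [← congrFun hCx i, Matrix.mulVec, dotProduct]
      refine Finset.sum_congr rfl fun k _ => ?_
      by_cases hk : k = 0
      · subst hk; simp [hR]
      · simp [hR, hk]
    | succ j =>
      simp [hR, hC, Matrix.one_apply]
  have hx0 : x 0 ≠ 0 := by
    intro h0
    apply hB
    rw [hfac, Matrix.det_mul, Matrix.det_mul, Matrix.det_diagonal, Fin.prod_univ_succ]
    simp [h0]
  let σ : Equiv.Perm (Fin (n + 1)) := Equiv.swap 0 (Fin.last n)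
  let S : Matrix (Fin (n + 1)) (Fin (n + 1)) ℤ :=
    Matrix.diagonal (fun i => if i = 0 then (x 0).sign else 1)
  have hS : IsUnit S.det := by
    rw [Matrix.det_diagonal, Fin.prod_univ_succ]
    simpa [Int.isUnit_iff_natAbs_eq] using Int.natAbs_sign_of_ne_zero hx0
  refine ⟨|x 0|, abs_pos.mpr hx0, (C * S).submatrix id σ, R.submatrix σ id, ?_, ?_, ?_⟩
  · rw [Matrix.det_permute', Matrix.det_mul]
    exact (Units.isUnit _).map (Int.castRingHom ℤ) |>.mul (hr.mul hS)
  · rw [Matrix.det_permute, hRdet, mul_one]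
    exact (Units.isUnit _).map (Int.castRingHom ℤ)
  · have hD : Matrix.diagonal (fun i => if i = Fin.last n then |x 0| else 1) =
        (Matrix.diagonal (fun i : Fin (n + 1) => if i = 0 then |x 0| else 1)).submatrix σ σ := by
      rw [Matrix.submatrix_diagonal_equiv]
      congr 1
      funext i
      simp [σ, Equiv.swap_apply_eq_iff]
    rw [hD, Matrix.submatrix_mul_equiv, Matrix.submatrix_mul_equiv, Matrix.submatrix_id_id,
      Matrix.mul_assoc C S, Matrix.diagonal_mul_diagonal]
    have hsign : (fun i : Fin (n + 1) => if i = 0 then x 0 else 1) =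
        fun i => (if i = 0 then (x 0).sign else 1) * (if i = 0 then |x 0| else 1) := by
      funext i
      split_ifs
      · exact (Int.sign_mul_abs _).symm
      · exact (one_mul 1).symm
    rw [hsign] at hfac
    exact hfac

/-- The columns of an integer matrix other than the first form a primitive set as soon as the
first column can be replaced so as to give a unimodular matrix. -/
theorem mem_span_int_of_isUnit_det_updateCol {n : ℕ}
    (B : Matrix (Fin (n + 1)) (Fin (n + 1)) ℤ) (r : Fin (n + 1) → ℤ)
    (hr : IsUnit (B.updateCol 0 r).det) (z : Fin (n + 1) → ℤ)
    (hz : toReal z ∈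
      Submodule.span ℝ (Set.range (fun j : Fin n => toReal (fun i => B i j.succ)))) :
    z ∈ Submodule.span ℤ (Set.range (fun j : Fin n => fun i => B i j.succ)) := by
  set C := B.updateCol 0 r with hC
  set y : Fin (n + 1) → ℤ := C⁻¹.mulVec z with hy
  have hCy : C.mulVec y = z := by
    rw [hy, Matrix.mulVec_mulVec, Matrix.mul_nonsing_inv _ hr, Matrix.one_mulVec]
  obtain ⟨c, hc⟩ := (Submodule.mem_span_range_iff_exists_fun ℝ).mp hz
  have hy0 : y 0 = 0 := by
    have hinj : Function.Injective (C.map (Int.cast : ℤ → ℝ)).mulVec := by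
      rw [Matrix.mulVec_injective_iff_isUnit, Matrix.isUnit_iff_isUnit_det]
      have := hr.map (Int.castRingHom ℝ)
      rwa [RingHom.map_det] at this
    have heq : (fun i => (y i : ℝ)) = Fin.cons 0 c := by
      apply hinj
      funext i
      have h1 := congrArg (Int.cast : ℤ → ℝ) (congrFun hCy i)
      have h2 := congrFun hc i
      simp only [Matrix.mulVec, dotProduct, Int.cast_sum, Int.cast_mul] at h1
      simp only [Finset.sum_apply, Pi.smul_apply, smul_eq_mul, toReal] at h2
      simp only [Matrix.mulVec, dotProduct, Matrix.map_apply]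
      rw [h1, ← h2, Fin.sum_univ_succ]
      simp [hC, mul_comm]
    exact Int.cast_eq_zero.mp (congrFun heq 0)
  rw [Submodule.mem_span_range_iff_exists_fun]
  refine ⟨fun j => y j.succ, ?_⟩
  rw [← hCy]
  funext i
  rw [Matrix.mulVec, dotProduct, Fin.sum_univ_succ, hy0]
  simp [hC, mul_comm]

/-- The cofactors along the first column of an integer matrix are relatively prime when the other
columns form a primitive set. -/
theorem isUnit_of_forall_dvd_adjugate {n : ℕ} (B : Matrix (Fin (n + 1)) (Fin (n + 1)) ℤ)
    (hli : LinearIndependent ℤ (fun j : Fin n => fun i => B i j.succ))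
    (hprim : ∀ z : Fin (n + 1) → ℤ,
      toReal z ∈ Submodule.span ℝ (Set.range (fun j : Fin n => toReal (fun i => B i j.succ))) →
      z ∈ Submodule.span ℤ (Set.range (fun j : Fin n => fun i => B i j.succ)))
    (e : ℤ) (he : ∀ j, e ∣ B.adjugate 0 j) : IsUnit e := by
  by_contra hne
  rw [Int.isUnit_iff_natAbs_eq] at hne
  obtain ⟨p, hp, hpe⟩ := Nat.exists_prime_and_dvd hne
  have : Fact p.Prime := ⟨hp⟩
  have hpe' : (p : ℤ) ∣ e := Int.natCast_dvd.mpr hpe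
  have hdep := not_linearIndependent_of_adjugate_row_eq_zero (B.map (Int.castRingHom (ZMod p)))
    (fun j => by
      have h := congrFun (congrFun (RingHom.map_adjugate (Int.castRingHom (ZMod p)) B) 0) j
      simp only [RingHom.mapMatrix_apply, Matrix.map_apply] at h
      rw [← h]
      exact (ZMod.intCast_zmod_eq_zero_iff_dvd _ _).mpr (hpe'.trans (he j)))
  rw [Fintype.not_linearIndependent_iff] at hdep
  obtain ⟨g, hg, k, hk⟩ := hdep
  choose y hy using fun j => ZMod.intCast_surjective (g j)
  have hdvd : ∀ i, (p : ℤ) ∣ ∑ j, y j * B i j.succ := fun i => by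
    rw [← ZMod.intCast_zmod_eq_zero_iff_dvd]
    simpa [hy] using congrFun hg i
  choose z hz using hdvd
  have hp0 : (p : ℝ) ≠ 0 := by exact_mod_cast hp.ne_zero
  have hzmem := hprim z <| by
    rw [Submodule.mem_span_range_iff_exists_fun]
    refine ⟨fun j => (y j : ℝ) / p, ?_⟩
    funext i
    have h := congrArg (Int.cast : ℤ → ℝ) (hz i)
    push_cast at h
    simp only [Finset.sum_apply, Pi.smul_apply, smul_eq_mul, toReal]
    rw [← mul_right_inj' hp0, ← h, Finset.mul_sum]
    refine Finset.sum_congr rfl fun j _ => ?_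
    field_simp
  obtain ⟨t, ht⟩ := (Submodule.mem_span_range_iff_exists_fun ℤ).mp hzmem
  have hyt := Fintype.linearIndependent_iff.mp hli (fun j => y j - p * t j) <| by
    funext i
    have h := congrFun ht i
    simp only [Finset.sum_apply, Pi.smul_apply, smul_eq_mul] at h
    simp only [Finset.sum_apply, Pi.smul_apply, smul_eq_mul, sub_mul, Finset.sum_sub_distrib, hz,
      mul_assoc, ← Finset.mul_sum, h, sub_self, Pi.zero_apply]
  apply hk
  rw [← hy, sub_eq_zero.mp (hyt k)]
  simp

/-- for a nonsingular `B ∈ ℤ^{k×k}` with `B'` obtained by deleting the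
first column, the SNF of `B` has diagonal `(1,…,1,d)` and the first row of `adj(B)` has
relatively prime entries, if and only if the columns of `B'` form a primitive set, i.e.,
a `ℤ`-basis of the lattice of integer points of their real linear span. -/
theorem snf_adjugate_iff_primitive (n : ℕ) (B : Matrix (Fin (n + 1)) (Fin (n + 1)) ℤ)
    (hB : B.det ≠ 0) :
    ((∃ d : ℤ, 0 < d ∧ ∃ U V : Matrix (Fin (n + 1)) (Fin (n + 1)) ℤ,
        IsUnit U.det ∧ IsUnit V.det ∧
        B = U * Matrix.diagonal (fun i => if i = Fin.last n then d else 1) * V) ∧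
      (∀ e : ℤ, (∀ j, e ∣ B.adjugate 0 j) → IsUnit e)) ↔
    (LinearIndependent ℤ (fun j : Fin n => fun i => B i j.succ) ∧
      ∀ z : Fin (n + 1) → ℤ,
        toReal z ∈ Submodule.span ℝ (Set.range (fun j : Fin n => toReal (fun i => B i j.succ))) →
        z ∈ Submodule.span ℤ (Set.range (fun j : Fin n => fun i => B i j.succ))) := by
  constructor
  · rintro ⟨-, hcop⟩
    obtain ⟨r, hr⟩ := exists_sum_mul_eq_one_of_forall_dvd_isUnit _ hcop
    rw [← det_updateCol_eq_sum_adjugate] at hr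
    have hcols : LinearIndependent ℤ B.col := Matrix.linearIndependent_cols_of_det_ne_zero hB
    exact ⟨hcols.comp Fin.succ (Fin.succ_injective n),
      mem_span_int_of_isUnit_det_updateCol B r (hr ▸ isUnit_one)⟩
  · rintro ⟨hli, hprim⟩
    have hcop := isUnit_of_forall_dvd_adjugate B hli hprim
    obtain ⟨r, hr⟩ := exists_sum_mul_eq_one_of_forall_dvd_isUnit _ hcop
    rw [← det_updateCol_eq_sum_adjugate] at hr
    exact ⟨exists_smith_of_isUnit_det_updateCol B hB r (hr ▸ isUnit_one), hcop⟩
end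

section
/- Let M ∈ ℤ^{k×k} be a full-rank integer matrix with columns v₁,…,v_k, let C = cone(v₁,…,v_k), let t = v₁ + ⋯ + v_k, and for each positive integer r let C_r = cone(rv₁ − t, …, rv_k − t). Then for every integer r > k: (a) each generator v_i of C lies in the topological interior of C_r (hence C \ {0} ⊆ interior(C_r)); and (b) each vector (r+1)v_i − t (a generator of C_{r+1}) lies in the interior of C_r. -/
open scoped BigOperators

/-- A combination of linearly independent vectors `u i` lies in the interior of the cone generated
by the `r • u i - ∑ j, u j` as soon as its coordinates in that basis are positive. -/
theorem sum_smul_mem_interior_coneGen {k : ℕ} {u : Fin k → (Fin k → ℝ)}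
    (hu : LinearIndependent ℝ u) {r : ℝ} (hr : (k : ℝ) < r) {d : Fin k → ℝ}
    (hd : ∀ i, 0 < d i * (r - k) + ∑ j, d j) :
    ∑ i, d i • u i ∈ interior (coneGen (fun i => r • u i - ∑ j, u j)) := by
  let b : Module.Basis (Fin k) ℝ (Fin k → ℝ) :=
    .mk hu (hu.span_eq_top_of_card_eq_finrank' (by simp)).ge
  have hb : ∀ c : Fin k → ℝ, b.equivFun (∑ i, c i • u i) = c := fun c => by
    have := b.equivFun.apply_symm_apply c
    rwa [b.equivFun_symm_apply, Module.Basis.coe_mk] at this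
  have hcont : Continuous fun x => b.equivFun x :=
    LinearMap.continuous_of_finiteDimensional b.equivFun.toLinearMap
  have hopen : IsOpen {x | ∀ i, 0 < b.equivFun x i * (r - k) + ∑ j, b.equivFun x j} := by
    rw [Set.ofPred_forall]
    exact isOpen_iInter_of_finite fun i => isOpen_lt continuous_const (by fun_prop)
  refine interior_maximal ?_ hopen (by simpa only [Set.mem_ofPred_eq, hb] using hd)
  intro x hx
  have hrk : 0 < r - k := sub_pos.2 hr
  have hr0 : 0 < r := lt_of_le_of_lt k.cast_nonneg hr
  refine ⟨fun i => (b.equivFun x i * (r - k) + ∑ j, b.equivFun x j) / (r * (r - k)),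
    fun i => (div_pos (hx i) (mul_pos hr0 hrk)).le, ?_⟩
  have hx_sum : x = ∑ i, b.equivFun x i • u i := by
    simpa [b, Module.Basis.coe_mk] using (b.sum_equivFun x).symm
  set e := b.equivFun x
  have hsum : ∑ i, (e i * (r - k) + ∑ j, e j) / (r * (r - k)) = (∑ j, e j) / (r - k) := by
    rw [← Finset.sum_div, Finset.sum_add_distrib, ← Finset.sum_mul]
    simp only [Finset.sum_const, Finset.card_univ, Fintype.card_fin, nsmul_eq_mul]
    field_simp
    ring
  simp only [smul_sub, Finset.sum_sub_distrib]
  rw [← Finset.sum_smul, hsum, Finset.smul_sum, ← Finset.sum_sub_distrib, hx_sum]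
  refine Finset.sum_congr rfl fun i _ => ?_
  rw [smul_smul, ← sub_smul]
  congr 1
  field_simp
  ring

theorem toReal_smul_sub_sum {k : ℕ} (v : Fin k → (Fin k → ℤ)) (n : ℤ) (i : Fin k) :
    toReal (n • v i - ∑ j, v j) = (n : ℝ) • toReal (v i) - ∑ j, toReal (v j) := by
  ext l
  simp [toReal]

/-- with `C = cone(v₁,…,v_k)` for linearly independent integer vectors,
`t = v₁ + ⋯ + v_k`, and `C_r = cone(r v₁ − t, …, r v_k − t)`, for every integer `r > k`:
(a) each `v_i` lies in the interior of `C_r`, and hence `C \ {0} ⊆ interior C_r`;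
(b) each `(r+1) v_i − t` lies in the interior of `C_r`. -/
theorem cone_chain (k : ℕ) (v : Fin k → (Fin k → ℤ))
    (hv : LinearIndependent ℝ (fun i => toReal (v i)))
    (r : ℕ) (hr : k < r) :
    (∀ i, toReal (v i) ∈
        interior (coneGen (fun i => toReal ((r : ℤ) • v i - ∑ j, v j)))) ∧
    (∀ x ∈ coneGen (fun i => toReal (v i)), x ≠ 0 →
        x ∈ interior (coneGen (fun i => toReal ((r : ℤ) • v i - ∑ j, v j)))) ∧
    (∀ i, toReal (((r : ℤ) + 1) • v i - ∑ j, v j) ∈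
        interior (coneGen (fun i => toReal ((r : ℤ) • v i - ∑ j, v j)))) := by
  have hr' : (k : ℝ) < r := by exact_mod_cast hr
  have hrk : 0 < (r : ℝ) - k := sub_pos.2 hr'
  simp only [toReal_smul_sub_sum]
  push_cast
  have cone_mem : ∀ x ∈ coneGen (fun i => toReal (v i)), x ≠ 0 →
      x ∈ interior (coneGen (fun i => (r : ℝ) • toReal (v i) - ∑ j, toReal (v j))) := by
    rintro x ⟨c, hc, rfl⟩ hx
    refine sum_smul_mem_interior_coneGen hv hr' fun i =>
      add_pos_of_nonneg_of_pos (mul_nonneg (hc i) hrk.le) ?_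
    refine (Finset.sum_nonneg fun j _ => hc j).lt_of_ne' fun h => hx ?_
    rw [Finset.sum_eq_zero_iff_of_nonneg fun j _ => hc j] at h
    exact Finset.sum_eq_zero fun j hj => by rw [h j hj, zero_smul]
  refine ⟨fun i => cone_mem _ ⟨Pi.single i 1, fun j => ?_, ?_⟩ (hv.ne_zero i), cone_mem,
    fun i => ?_⟩
  · exact (Pi.single_nonneg (α := fun _ => ℝ)).2 zero_le_one j
  · simp [Pi.single_apply]
  · have hcomb : ((r : ℝ) + 1) • toReal (v i) - ∑ j, toReal (v j) =
        ∑ j, ((Pi.single i ((r : ℝ) + 1) : Fin k → ℝ) j - 1) • toReal (v j) := by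
      simp [sub_smul, Pi.single_apply]
    rw [hcomb]
    refine sum_smul_mem_interior_coneGen hv hr' fun j => ?_
    have hj : 0 ≤ (Pi.single i ((r : ℝ) + 1) : Fin k → ℝ) j :=
      (Pi.single_nonneg (α := fun _ => ℝ)).2 (by positivity) j
    have hsum : ∑ l, ((Pi.single i ((r : ℝ) + 1) : Fin k → ℝ) l - 1) = r + 1 - k := by
      simp
    rw [hsum]
    nlinarith [mul_nonneg hj hrk.le]
end

section
/- Let M ∈ ℤ^{k×k} be a full-rank integer matrix with columns v₁,…,v_k, let C = cone(v₁,…,v_k), let t = v₁ + ⋯ + v_k, and for each positive integer r let C_r = cone(rv₁ − t, …, rv_k − t). Fix an integer r > k and set w_i = (r+1)v_i − t for i = 1,…,k. Then there exists ε > 0 such that for all real vectors w'₁,…,w'_k ∈ ℝ^k with ‖w'_i − w_i‖_∞ < ε for each i, the cone C' = cone(w'₁,…,w'_k) satisfies C ⊆ C' ⊆ C_r. -/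
open scoped BigOperators

/-- If the rows of `X` are nonnegative combinations of the rows of `U`, then the cone generated by
the rows of `X` lies in the one generated by the rows of `U`. -/
theorem coneGen_mul_subset {m n l : ℕ} (P : Matrix (Fin m) (Fin n) ℝ)
    (U : Matrix (Fin n) (Fin l) ℝ) (hP : ∀ i j, 0 ≤ P i j) : coneGen (P * U) ⊆ coneGen U := by
  rintro x ⟨c, hc, rfl⟩
  refine ⟨Matrix.vecMul c P, fun j => ?_, ?_⟩
  · exact dotProduct_nonneg_of_nonneg hc fun i => hP i j
  have h := Matrix.vecMul_vecMul c P U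
  rw [Matrix.vecMul_eq_sum (Matrix.vecMul c P), Matrix.vecMul_eq_sum c (P * U)] at h
  exact h.symm

/-- If the rows of an invertible matrix `X` are strictly positive combinations of the rows of `U`,
then the inclusion of cones persists under small perturbations of both matrices. -/
theorem eventually_coneGen_subset {k : ℕ} {α : Type*} {l : Filter α}
    {f g : α → Matrix (Fin k) (Fin k) ℝ} {X U P : Matrix (Fin k) (Fin k) ℝ}
    (hf : Filter.Tendsto f l (nhds X)) (hg : Filter.Tendsto g l (nhds U))
    (hX : X.det ≠ 0) (h : X = P * U) (hP : ∀ i j, 0 < P i j) :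
    ∀ᶠ a in l, coneGen (f a) ⊆ coneGen (g a) := by
  have hU : U.det ≠ 0 := fun h0 => hX (by rw [h, Matrix.det_mul, h0, mul_zero])
  have hdet : Filter.Tendsto (fun a => (g a).det) l (nhds U.det) :=
    ((continuous_id.matrix_det).tendsto U).comp hg
  have hadj : Filter.Tendsto (fun a => (g a).adjugate) l (nhds U.adjugate) :=
    ((continuous_id.matrix_adjugate).tendsto U).comp hg
  have hlim : Filter.Tendsto (fun a => f a * ((g a).det⁻¹ • (g a).adjugate)) l (nhds P) := by
    have hPX : X * (U.det⁻¹ • U.adjugate) = P := by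
      rw [h, Matrix.mul_assoc, Matrix.mul_smul, Matrix.mul_adjugate, smul_smul,
        inv_mul_cancel₀ hU, one_smul, Matrix.mul_one]
    rw [← hPX]
    exact hf.mul ((hdet.inv₀ hU).smul hadj)
  have hpos : ∀ᶠ a in l, ∀ i j, 0 < (f a * ((g a).det⁻¹ • (g a).adjugate)) i j := by
    simp only [Filter.eventually_all]
    intro i j
    exact (tendsto_pi_nhds.1 (tendsto_pi_nhds.1 hlim i) j).eventually_const_lt (hP i j)
  filter_upwards [hpos, hdet.eventually_ne hU] with a ha hda
  have := coneGen_mul_subset _ (g a) fun i j => (ha i j).le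
  rwa [Matrix.mul_assoc, Matrix.smul_mul, Matrix.adjugate_mul, smul_smul, inv_mul_cancel₀ hda,
    one_smul, Matrix.mul_one] at this

/-- Recovering `b * V i` plus a multiple of the sum of the rows from the rows
`s * V i - ∑ l, V l`. -/
theorem scalar_add_const_mul_sub_sum {k : ℕ} (V : Matrix (Fin k) (Fin k) ℝ) (s a b : ℝ) :
    (Matrix.of fun i j => (if i = j then b else 0) + a) *
      (Matrix.of fun i j => s * V i j - ∑ l, V l j) =
    Matrix.of fun i j => b * (s * V i j) + (a * (s - k) - b) * ∑ l, V l j := by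
  ext i j
  simp only [Matrix.mul_apply, Matrix.of_apply, add_mul, ite_mul, zero_mul,
    Finset.sum_add_distrib, Finset.sum_ite_eq, Finset.mem_univ, if_true, ← Finset.mul_sum,
    Finset.sum_sub_distrib, Finset.sum_const, Finset.card_univ, Fintype.card_fin, nsmul_eq_mul]
  ring

/-- with `C`, `t`, `C_r` as before and `w_i = (r+1) v_i − t` for a fixed
integer `r > k`, there is `ε > 0` such that whenever `‖w'_i − w_i‖_∞ < ε` for all `i`,
the cone `C' = cone(w'₁,…,w'_k)` satisfies `C ⊆ C' ⊆ C_r`. -/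
theorem cone_perturbation (k : ℕ) (v : Fin k → (Fin k → ℤ))
    (hv : LinearIndependent ℝ (fun i => toReal (v i)))
    (r : ℕ) (hr : k < r) :
    ∃ ε : ℝ, 0 < ε ∧ ∀ w' : Fin k → (Fin k → ℝ),
      (∀ i j, |w' i j - toReal (((r : ℤ) + 1) • v i - ∑ l, v l) j| < ε) →
      coneGen (fun i => toReal (v i)) ⊆ coneGen w' ∧
      coneGen w' ⊆ coneGen (fun i => toReal ((r : ℤ) • v i - ∑ l, v l)) := by
  set V : Matrix (Fin k) (Fin k) ℝ := Matrix.of fun i => toReal (v i) with hVdef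
  have hV : V.det ≠ 0 := by
    have : IsUnit V := Matrix.linearIndependent_rows_iff_isUnit.1 hv
    exact ((Matrix.isUnit_iff_isUnit_det V).1 this).ne_zero
  set W : Matrix (Fin k) (Fin k) ℝ := Matrix.of fun i j => (r + 1 : ℝ) * V i j - ∑ l, V l j
    with hWdef
  set U : Matrix (Fin k) (Fin k) ℝ := Matrix.of fun i j => (r : ℝ) * V i j - ∑ l, V l j with hUdef
  have hWv : ∀ i j, toReal (((r : ℤ) + 1) • v i - ∑ l, v l) j = W i j := by
    intro i j
    simp [toReal, hWdef, hVdef]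
  have hUv : (fun i => toReal ((r : ℤ) • v i - ∑ l, v l)) = U := by
    ext i j
    simp [toReal, hUdef, hVdef]
  have hkr : (0 : ℝ) < r - k := sub_pos.2 (by exact_mod_cast hr)
  have hk : (0 : ℝ) ≤ k := k.cast_nonneg
  have hr0 : (0 : ℝ) < r := by linarith
  have hr1 : (0 : ℝ) < r + 1 - k := by linarith
  obtain ⟨P, hP, hPW⟩ : ∃ P : Matrix (Fin k) (Fin k) ℝ, (∀ i j, 0 < P i j) ∧ V = P * W := by
    refine ⟨Matrix.of fun i j => (if i = j then (r + 1 : ℝ)⁻¹ else 0) +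
      (r + 1 : ℝ)⁻¹ * (r + 1 - k : ℝ)⁻¹, ?_, ?_⟩
    · intro i j
      simp only [Matrix.of_apply]
      split_ifs <;> positivity
    · rw [hWdef, scalar_add_const_mul_sub_sum]
      ext i j
      simp only [Matrix.of_apply]
      field_simp
      ring
  obtain ⟨Q, hQ, hQU⟩ : ∃ Q : Matrix (Fin k) (Fin k) ℝ, (∀ i j, 0 < Q i j) ∧ W = Q * U := by
    refine ⟨Matrix.of fun i j => (if i = j then (r + 1 : ℝ) * (r : ℝ)⁻¹ else 0) +
      (r : ℝ)⁻¹ * (r - k : ℝ)⁻¹, ?_, ?_⟩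
    · intro i j
      simp only [Matrix.of_apply]
      split_ifs <;> positivity
    · rw [hUdef, scalar_add_const_mul_sub_sum]
      ext i j
      simp only [hWdef, Matrix.of_apply]
      field_simp
      ring
  have hW : W.det ≠ 0 := fun h0 => hV (by rw [hPW, Matrix.det_mul, h0, mul_zero])
  have h₁ := eventually_coneGen_subset (tendsto_const_nhds (x := V))
    (Filter.tendsto_id (x := nhds W)) hV hPW hP
  have h₂ := eventually_coneGen_subset (Filter.tendsto_id (x := nhds W))
    (tendsto_const_nhds (x := U)) hW hQU hQ
  have h₃ : ∀ᶠ w' : Fin k → Fin k → ℝ in nhds (fun i j => W i j),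
      coneGen V ⊆ coneGen w' ∧ coneGen w' ⊆ coneGen U := h₁.and h₂
  obtain ⟨ε, hε, hball⟩ := Metric.eventually_nhds_iff.1 h₃
  refine ⟨ε, hε, fun w' hw' => ?_⟩
  rw [hUv]
  refine hball ((dist_pi_lt_iff hε).2 fun i => (dist_pi_lt_iff hε).2 fun j => ?_)
  rw [Real.dist_eq, ← hWv]
  exact hw' i j
end

section
/- Let M ∈ ℤ^{k×k} be a full-rank integer matrix such that S = s(M) is a numerical semigroup with gcd(S) = 1. Then there exists a real matrix B₀ ∈ ℝ^{k×k} such that for every positive integer q, every nonsingular integer matrix B ∈ ℤ^{k×k} with ‖B − qB₀‖_∞ < q/2 satisfies s(adj(B)) = S. -/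
open scoped BigOperators

open Filter Topology Matrix in
/-- A functional which is a strictly positive combination of the rows of `N₀` stays nonnegative
on the cone `{x | 0 ≤ N *ᵥ x}` for all `N` near `N₀`. -/
theorem eventually_dotProduct_nonneg {n : Type*} [Fintype n] [DecidableEq n]
    {N₀ : Matrix n n ℝ} (hN₀ : 0 < N₀.det) {v p : n → ℝ} (hp : ∀ i, 0 < p i)
    (hv : v = p ᵥ* N₀) :
    ∀ᶠ N in 𝓝 N₀, ∀ x : n → ℝ, (∀ i, 0 ≤ (N *ᵥ x) i) → 0 ≤ v ⬝ᵥ x := by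
  have hdet : ∀ᶠ N : Matrix n n ℝ in 𝓝 N₀, 0 < N.det :=
    (continuous_id.matrix_det.tendsto N₀).eventually_const_lt hN₀
  have hadj : ∀ᶠ N : Matrix n n ℝ in 𝓝 N₀, ∀ i, 0 < (v ᵥ* N.adjugate) i := by
    refine eventually_all.2 fun i => ?_
    have hc : Continuous fun N : Matrix n n ℝ => (v ᵥ* N.adjugate) i :=
      (continuous_apply i).comp (continuous_const.matrix_vecMul continuous_id.matrix_adjugate)
    refine (hc.tendsto N₀).eventually_const_lt ?_
    rw [hv, vecMul_vecMul, mul_adjugate, vecMul_smul, vecMul_one]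
    exact mul_pos hN₀ (hp i)
  filter_upwards [hdet, hadj] with N hN hadj x hx
  have h : N.det * (v ⬝ᵥ x) = (v ᵥ* N.adjugate) ⬝ᵥ (N *ᵥ x) := by
    rw [← dotProduct_mulVec, mulVec_mulVec, adjugate_mul, smul_mulVec, one_mulVec,
      dotProduct_smul, smul_eq_mul]
  refine nonneg_of_mul_nonneg_right (a := N.det) ?_ hN
  rw [h]
  exact Finset.sum_nonneg fun i _ => mul_nonneg (hadj i).le (hx i)

open Filter Topology Matrix in
/-- The cone `{x | 0 ≤ L *ᵥ x}`, on which the functional `e` is nonnegative, can be deformed to an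
open family of simplicial cones which contain prescribed points with `e` positive, and whose
slices by the level sets of `e` are arbitrarily close to those of the original cone. -/
theorem exists_eventually_cone_approx {n : Type*} [Fintype n] [DecidableEq n]
    (L : Matrix n n ℝ) (hL : 0 < L.det) (e m : n → ℝ) {D θ : ℝ} (hD : 0 < D) (hθ : 0 < θ)
    (hm : ∀ i, 0 ≤ m i) (hm' : 0 < ∑ i, m i) (hmL : m ᵥ* L = D • e)
    (Z : Finset (n → ℝ)) (hZ : ∀ z ∈ Z, (∀ i, 0 ≤ (L *ᵥ z) i) ∧ 0 < e ⬝ᵥ z) :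
    ∃ N₀ : Matrix n n ℝ, ∀ᶠ N in 𝓝 N₀, 0 < N.det ∧
      (∀ x : n → ℝ, (∀ i, 0 ≤ (N *ᵥ x) i) →
        0 ≤ e ⬝ᵥ x ∧ ∀ i, -(θ * (e ⬝ᵥ x)) ≤ (L *ᵥ x) i) ∧
      ∀ z ∈ Z, ∀ i, 0 ≤ (N *ᵥ z) i := by
  set s := ∑ i, m i with hs
  -- enlarge the cone so that the prescribed points become interior
  obtain ⟨η, hη, hηθ, hdet'⟩ : ∃ η : ℝ, 0 < η ∧ 2 * η < θ ∧
      0 < (L + η • vecMulVec 1 e).det := by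
    have hc : Continuous fun η : ℝ => (L + η • vecMulVec 1 e).det := by fun_prop
    have h1 : ∀ᶠ η in 𝓝[>] (0 : ℝ), 0 < (L + η • vecMulVec 1 e).det :=
      ((hc.tendsto 0).eventually_const_lt (by simpa using hL)).filter_mono nhdsWithin_le_nhds
    have h2 : ∀ᶠ η in 𝓝[>] (0 : ℝ), 2 * η < θ :=
      (((continuous_const.mul continuous_id).tendsto (0 : ℝ)).eventually_lt_const
        (by simpa using hθ)).filter_mono nhdsWithin_le_nhds
    obtain ⟨η, ⟨h1, h2⟩, h3⟩ := ((h1.and h2).and self_mem_nhdsWithin).exists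
    exact ⟨η, h3, h2, h1⟩
  set L' := L + η • vecMulVec 1 e with hL'
  have hmL' : m ᵥ* L' = (D + η * s) • e := by
    rw [hL', vecMul_add, hmL, vecMul_smul, vecMul_vecMulVec, dotProduct_one, ← hs, smul_smul,
      add_smul]
  have hL'x (x : n → ℝ) (i : n) : (L' *ᵥ x) i = (L *ᵥ x) i + η * (e ⬝ᵥ x) := by
    rw [hL', add_mulVec, smul_mulVec, vecMulVec_mulVec]
    simp
  -- shrink it so that the functional becomes positive
  let K : Matrix n n ℝ := vecMulVec 1 1
  have hKK : K * K = (Fintype.card n : ℝ) • K := by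
    ext i j; simp [K, Matrix.mul_apply]
  obtain ⟨δ, hδ, hδ1, hδdet, hδZ⟩ : ∃ δ : ℝ, 0 < δ ∧ δ * (Fintype.card n : ℝ) < 1 ∧
      0 < ((1 - δ • K) * L').det ∧ ∀ z ∈ Z, ∀ i, 0 < (((1 - δ • K) * L') *ᵥ z) i := by
    have hM : Continuous fun δ : ℝ => (1 - δ • K) * L' := by fun_prop
    have h1 : ∀ᶠ δ in 𝓝[>] (0 : ℝ), 0 < ((1 - δ • K) * L').det :=
      ((hM.matrix_det.tendsto 0).eventually_const_lt (by simpa using hdet')).filter_mono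
        nhdsWithin_le_nhds
    have h2 : ∀ᶠ δ in 𝓝[>] (0 : ℝ), δ * (Fintype.card n : ℝ) < 1 :=
      (((continuous_mul_const (Fintype.card n : ℝ)).tendsto 0).eventually_lt_const
        (by simp)).filter_mono nhdsWithin_le_nhds
    have h3 : ∀ᶠ δ in 𝓝[>] (0 : ℝ), ∀ z ∈ Z, ∀ i, 0 < (((1 - δ • K) * L') *ᵥ z) i := by
      refine (Filter.eventually_all_finset Z).2 fun z hz => eventually_all.2 fun i => ?_
      have hc : Continuous fun δ : ℝ => (((1 - δ • K) * L') *ᵥ z) i :=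
        (continuous_apply i).comp (hM.matrix_mulVec continuous_const)
      refine ((hc.tendsto 0).eventually_const_lt ?_).filter_mono nhdsWithin_le_nhds
      simp only [zero_smul, sub_zero, one_mul, hL'x]
      have := (hZ z hz).1 i
      have := mul_pos hη (hZ z hz).2
      linarith
    obtain ⟨δ, ⟨⟨h1, h2⟩, h3⟩, h4⟩ := (((h1.and h2).and h3).and self_mem_nhdsWithin).exists
    exact ⟨δ, h4, h2, h1, h3⟩
  set N₀ := (1 - δ • K) * L' with hN₀
  obtain ⟨ε, hε, hεL⟩ : ∃ ε : ℝ, 0 < ε ∧ L' = (1 + ε • K) * N₀ := by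
    have h1 : 0 < 1 - δ * (Fintype.card n : ℝ) := by linarith
    refine ⟨δ / (1 - δ * (Fintype.card n : ℝ)), by positivity, ?_⟩
    set ε := δ / (1 - δ * (Fintype.card n : ℝ)) with hε
    have h2 : ε - δ - ε * δ * (Fintype.card n : ℝ) = 0 := by
      rw [hε]; field_simp; ring
    have h3 : (1 + ε • K) * (1 - δ • K) = 1 + (ε - δ - ε * δ * (Fintype.card n : ℝ)) • K := by
      rw [add_mul, mul_sub, mul_sub, smul_mul_smul_comm, hKK]
      simp only [one_mul, mul_one]
      module
    rw [hN₀, ← Matrix.mul_assoc, h3, h2, zero_smul, add_zero, Matrix.one_mul]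
  have hL'row (a : n → ℝ) : a ᵥ* L' = (a + (ε * ∑ i, a i) • 1) ᵥ* N₀ := by
    rw [hεL, ← vecMul_vecMul, vecMul_add, vecMul_one, vecMul_smul, vecMul_vecMulVec,
      dotProduct_one, smul_smul]
  have hc : 0 < D + η * s := by positivity
  obtain ⟨p, hp, hpe⟩ : ∃ p : n → ℝ, (∀ i, 0 < p i) ∧ e = p ᵥ* N₀ := by
    refine ⟨(D + η * s)⁻¹ • (m + (ε * s) • 1), fun i => ?_, ?_⟩
    · have := hm i
      have : 0 < m i + ε * s := by positivity
      simpa using mul_pos (inv_pos.2 hc) this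
    · rw [smul_vecMul, ← hL'row, hmL', smul_smul, inv_mul_cancel₀ hc.ne', one_smul]
  have hrow (i : n) : ∃ p : n → ℝ, (∀ j, 0 < p j) ∧ L i + (2 * η) • e = p ᵥ* N₀ := by
    refine ⟨(Pi.single i 1 + ε • 1) + η • p, fun j => ?_, ?_⟩
    · have h1 : (0 : ℝ) ≤ (Pi.single i 1 : n → ℝ) j := by
        by_cases h : j = i <;> simp [h]
      have h2 := mul_pos hη (hp j)
      simp only [Pi.add_apply, Pi.smul_apply, Pi.one_apply, smul_eq_mul, mul_one]
      linarith
    · have h := hL'row (Pi.single i 1)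
      rw [Finset.sum_pi_single' i (1 : ℝ) Finset.univ, if_pos (Finset.mem_univ i), mul_one] at h
      rw [add_vecMul, smul_vecMul, ← hpe, ← h, single_one_vecMul]
      ext j
      simp [hL', Matrix.row]
      ring
  refine ⟨N₀, ?_⟩
  have h1 : ∀ᶠ N : Matrix n n ℝ in 𝓝 N₀, 0 < N.det :=
    (continuous_id.matrix_det.tendsto N₀).eventually_const_lt hδdet
  have h2 : ∀ᶠ N : Matrix n n ℝ in 𝓝 N₀, ∀ z ∈ Z, ∀ i, 0 < (N *ᵥ z) i := by
    refine (Filter.eventually_all_finset Z).2 fun z hz => eventually_all.2 fun i => ?_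
    have hc : Continuous fun N : Matrix n n ℝ => (N *ᵥ z) i :=
      (continuous_apply i).comp (continuous_id.matrix_mulVec continuous_const)
    exact (hc.tendsto N₀).eventually_const_lt (hδZ z hz i)
  have h3 : ∀ᶠ N : Matrix n n ℝ in 𝓝 N₀, ∀ i, ∀ x : n → ℝ, (∀ i, 0 ≤ (N *ᵥ x) i) →
      0 ≤ (L i + (2 * η) • e) ⬝ᵥ x :=
    eventually_all.2 fun i =>
      let ⟨_, hp, h⟩ := hrow i
      eventually_dotProduct_nonneg hδdet hp h
  filter_upwards [h1, h2, h3, eventually_dotProduct_nonneg hδdet hp hpe] with N h1 h2 h3 h4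
  refine ⟨h1, fun x hx => ⟨h4 x hx, fun i => ?_⟩, fun z hz i => (h2 z hz i).le⟩
  have h5 := h3 i x hx
  rw [add_dotProduct, smul_dotProduct, smul_eq_mul] at h5
  have h6 := mul_le_mul_of_nonneg_right hηθ.le (h4 x hx)
  change _ ≤ L i ⬝ᵥ x
  linarith

open Matrix in
/-- The cone over the columns of `A` is cut out by the rows of `B` when `A * B` is a positive
scalar matrix. -/
theorem toReal_mem_coneGen_iff_s19 {k : ℕ} {A B : Matrix (Fin k) (Fin k) ℤ} {d : ℤ} (hd : 0 < d)
    (hAB : A * B = d • 1) (hBA : B * A = d • 1) (z : Fin k → ℤ) :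
    toReal z ∈ coneGen (fun i => toReal (fun r => A r i)) ↔ ∀ i, 0 ≤ (B *ᵥ z) i := by
  have hd' : (0 : ℝ) < d := by exact_mod_cast hd
  have hsum (c : Fin k → ℝ) : ∑ i, c i • toReal (fun r => A r i) = A.map (Int.cast) *ᵥ c := by
    ext r
    simp [toReal, mulVec, dotProduct, mul_comm]
  have hBz : (B.map Int.cast : Matrix _ _ ℝ) *ᵥ toReal z = toReal (B *ᵥ z) := by
    ext r
    simp [toReal, mulVec, dotProduct]
  have hcast {X Y : Matrix (Fin k) (Fin k) ℤ} (h : X * Y = d • 1) :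
      (X.map Int.cast : Matrix _ _ ℝ) * Y.map Int.cast = (d : ℝ) • 1 := by
    have h' := congrArg (fun W : Matrix (Fin k) (Fin k) ℤ => W.map (Int.castRingHom ℝ)) h
    simp only [Matrix.map_mul] at h'
    refine h'.trans ?_
    ext i j
    simp only [map_apply, Matrix.smul_apply, one_apply]
    split_ifs <;> simp
  constructor
  · rintro ⟨c, hc, hz⟩ i
    rw [hsum] at hz
    rw [hz, mulVec_mulVec, hcast hBA, smul_mulVec, one_mulVec] at hBz
    have h := congrFun hBz i
    have h' : (0 : ℝ) ≤ ((B *ᵥ z) i : ℤ) := (mul_nonneg hd'.le (hc i)).trans_eq h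
    exact_mod_cast h'
  · intro h
    refine ⟨(d : ℝ)⁻¹ • toReal (B *ᵥ z), fun i => ?_, ?_⟩
    · exact mul_nonneg (inv_nonneg.2 hd'.le) (by simpa [toReal] using h i)
    · rw [hsum, ← hBz, mulVec_smul, mulVec_mulVec, hcast hAB, smul_mulVec, one_mulVec, smul_smul,
        inv_mul_cancel₀ hd'.ne', one_smul]

/-- A cone does not depend on the order of its generators. -/
theorem coneGen_comp_equiv {m l : ℕ} (v : Fin l → (Fin m → ℝ)) (σ : Equiv.Perm (Fin l)) :
    coneGen (fun i => v (σ i)) = coneGen v := by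
  ext x
  constructor
  · rintro ⟨c, hc, rfl⟩
    refine ⟨fun i => c (σ.symm i), fun i => hc _, ?_⟩
    simpa using Equiv.sum_comp σ (fun i => c (σ.symm i) • v i)
  · rintro ⟨c, hc, rfl⟩
    exact ⟨fun i => c (σ i), fun i => hc _, (Equiv.sum_comp σ fun i => c i • v i).symm⟩

/-- Each generator lies in its cone. -/
theorem mem_coneGen {m l : ℕ} (v : Fin l → (Fin m → ℝ)) (i : Fin l) : v i ∈ coneGen v := by
  refine ⟨Pi.single i 1, fun j => ?_, ?_⟩
  · by_cases h : j = i <;> simp [h]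
  · simp [Pi.single_apply]

/-- A submonoid of `ℕ` with greatest common divisor one is cofinite and generated by finitely
many of its elements. -/
theorem exists_bound_of_gcd_eq_one {S : Set ℕ} (hS : IsNumericalSemigroup S)
    (hgcd : ∀ e : ℕ, (∀ n ∈ S, e ∣ n) → e = 1) :
    ∃ b : ℕ, (∀ n, b ≤ n → n ∈ S) ∧
      ∀ T : AddSubmonoid ℕ, (∀ n ∈ S, 0 < n → n ≤ b → n ∈ T) → S ⊆ T := by
  obtain ⟨t, a, hts, ha⟩ := Nat.exists_mem_span_nat_finset_of_ge S
  have h1 : Nat.setGcd S = 1 := hgcd _ fun n hn => Nat.setGcd_dvd_of_mem hn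
  have ha' (n : ℕ) (hn : a ≤ n) (T : AddSubmonoid ℕ) (hT : ∀ i ∈ t, i ∈ T) : n ∈ T := by
    have h := (Submodule.span_nat_eq_addSubmonoidClosure _).le (ha n hn (by simp [h1]))
    exact AddSubmonoid.closure_le.2 (fun i hi => hT i hi) h
  let S' : AddSubmonoid ℕ :=
    { carrier := S, zero_mem' := hS.1, add_mem' := fun hx hy => hS.2 _ hx _ hy }
  refine ⟨max a (t.sup id), fun n hn => ?_, fun T hT n hn => ?_⟩
  · exact ha' n (le_trans (le_max_left _ _) hn) S' fun i hi => hts hi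
  · rcases Nat.eq_zero_or_pos n with rfl | hn0
    · exact T.zero_mem
    rcases le_total n a with h | h
    · exact hT n hn hn0 (h.trans (le_max_left _ _))
    · refine ha' n h T fun i hi => ?_
      rcases Nat.eq_zero_or_pos i with rfl | hi0
      · exact T.zero_mem
      · exact hT i (hts hi) hi0 ((Finset.le_sup (f := id) hi).trans (le_max_right _ _))

/-- Columns may be permuted to make the determinant positive, provided that the first row is
nonnegative. -/
theorem exists_perm_det_pos {k : ℕ} (hk : 0 < k) (M : Matrix (Fin k) (Fin k) ℤ)
    (hM : M.det ≠ 0) (h0 : ∀ i, 0 ≤ M ⟨0, hk⟩ i) :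
    ∃ σ : Equiv.Perm (Fin k), 0 < (M.submatrix id σ).det := by
  rcases hM.lt_or_gt with h | h
  · obtain _ | _ | k := k
    · omega
    · rw [Matrix.det_fin_one] at h
      exact absurd (h0 0) (not_le.2 h)
    · refine ⟨Equiv.swap 0 1, ?_⟩
      rw [Matrix.det_permute', Equiv.Perm.sign_swap (by simp)]
      simpa using h
  · exact ⟨1, by simpa using h⟩

open Filter Topology Matrix in
/-- For a matrix with positive determinant, the projected semigroup of its cone is that of every
cone in some open family. -/
theorem exists_eventually_proj_eq {k : ℕ} (hk : 0 < k) (M : Matrix (Fin k) (Fin k) ℤ)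
    (hM : 0 < M.det) (S : Set ℕ) (hS : IsNumericalSemigroup S)
    (hgcd : ∀ e : ℕ, (∀ n ∈ S, e ∣ n) → e = 1) (h0 : ∀ i, 0 ≤ M ⟨0, hk⟩ i)
    (hSM : {t : ℤ | ∃ z : Fin k → ℤ,
        toReal z ∈ coneGen (fun i => toReal (fun r => M r i)) ∧ t = z ⟨0, hk⟩}
      = (fun n : ℕ => (n : ℤ)) '' S) :
    ∃ N₀ : Matrix (Fin k) (Fin k) ℝ, ∀ᶠ N in 𝓝 N₀, 0 < N.det ∧
      {t : ℤ | ∃ z : Fin k → ℤ, (∀ i, 0 ≤ (N *ᵥ toReal z) i) ∧ t = z ⟨0, hk⟩}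
        = (fun n : ℕ => (n : ℤ)) '' S := by
  set i₀ : Fin k := ⟨0, hk⟩
  obtain ⟨b, hb, hgen⟩ := exists_bound_of_gcd_eq_one hS hgcd
  have hcone := toReal_mem_coneGen_iff_s19 hM (mul_adjugate M) (adjugate_mul M)
  simp only [hcone] at hSM
  have hpt (n : ℕ) (hn : n ∈ S) :
      ∃ z : Fin k → ℤ, (∀ i, 0 ≤ (M.adjugate *ᵥ z) i) ∧ (n : ℤ) = z i₀ :=
    hSM.ge ⟨n, hn, rfl⟩
  choose! pt hpt hpt0 using hpt
  let L : Matrix (Fin k) (Fin k) ℝ := M.adjugate.map Int.cast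
  have hLz (z : Fin k → ℤ) (i : Fin k) : (L *ᵥ toReal z) i = ((M.adjugate *ᵥ z) i : ℤ) := by
    simp [L, toReal, mulVec, dotProduct]
  have hLdet : 0 < L.det := by
    have h : L.det = ((M.adjugate.det : ℤ) : ℝ) := (Int.cast_det M.adjugate).symm
    rw [h, det_adjugate]
    exact_mod_cast pow_pos hM _
  have hM0 : 0 < ∑ i, (M i₀ i : ℝ) := by
    refine (Finset.sum_nonneg fun i _ => by exact_mod_cast h0 i).lt_of_ne' fun h => hM.ne' ?_
    rw [Finset.sum_eq_zero_iff_of_nonneg fun i _ => by exact_mod_cast h0 i] at h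
    exact det_eq_zero_of_row_eq_zero i₀ fun j => by exact_mod_cast h j (Finset.mem_univ j)
  have hML : (fun i => (M i₀ i : ℝ)) ᵥ* L = (M.det : ℝ) • Pi.single i₀ 1 := by
    ext j
    have h := congrFun (congrFun (mul_adjugate M) i₀) j
    rw [mul_apply] at h
    have h' := congrArg (Int.cast : ℤ → ℝ) h
    push_cast at h'
    simp only [vecMul, dotProduct, L, map_apply]
    refine h'.trans ?_
    by_cases hj : j = i₀ <;> simp [one_apply, hj, eq_comm]
  let G : Set ℕ := {n | n ∈ S ∧ 0 < n ∧ n ≤ b}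
  have hG : G.Finite := (Set.finite_Iic b).subset fun n hn => hn.2.2
  obtain ⟨N₀, hN₀⟩ := exists_eventually_cone_approx L hLdet (Pi.single i₀ 1)
    (fun i => (M i₀ i : ℝ)) (D := M.det) (θ := ((b : ℝ) + 1)⁻¹) (by exact_mod_cast hM)
    (by positivity) (fun i => by exact_mod_cast h0 i) hM0 hML
    (hG.toFinset.image fun n => toReal (pt n)) (by
      simp only [Finset.mem_image, Set.Finite.mem_toFinset]
      rintro _ ⟨n, hn, rfl⟩
      refine ⟨fun i => ?_, ?_⟩
      · rw [hLz]
        exact_mod_cast hpt n hn.1 i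
      · simp only [single_dotProduct, one_mul, toReal, ← hpt0 n hn.1]
        exact_mod_cast hn.2.1)
  refine ⟨N₀, hN₀.mono fun N ⟨hdet, hcl, hZ⟩ => ⟨hdet, Set.Subset.antisymm ?_ ?_⟩⟩
  · rintro _ ⟨z, hz, rfl⟩
    obtain ⟨hz0, hzL⟩ := hcl _ hz
    simp only [single_dotProduct, one_mul] at hz0 hzL
    have hz0' : 0 ≤ z i₀ := by simpa [toReal] using hz0
    lift z i₀ to ℕ using hz0' with t ht
    rcases le_or_gt b t with hbt | hbt
    · exact ⟨t, hb t hbt, rfl⟩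
    · refine hSM.le ⟨z, fun i => ?_, ht⟩
      have h := hzL i
      rw [hLz, toReal, ← ht] at h
      have hlt : ((b : ℝ) + 1)⁻¹ * ((t : ℤ) : ℝ) < 1 := by
        rw [inv_mul_lt_iff₀ (by positivity)]
        have : (t : ℝ) < b := by exact_mod_cast hbt
        push_cast
        linarith
      have : (-1 : ℝ) < ((M.adjugate *ᵥ z) i : ℤ) := by linarith
      have : (-1 : ℤ) < (M.adjugate *ᵥ z) i := by exact_mod_cast this
      omega
  · let T : AddSubmonoid ℕ :=
      { carrier := {n | ∃ z : Fin k → ℤ, (∀ i, 0 ≤ (N *ᵥ toReal z) i) ∧ (n : ℤ) = z i₀}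
        zero_mem' := ⟨0, fun i => by simp [toReal, mulVec, dotProduct], by simp⟩
        add_mem' := by
          rintro x y ⟨z, hz, hx⟩ ⟨w, hw, hy⟩
          refine ⟨z + w, fun i => ?_, by simp [hx, hy]⟩
          have h : toReal (z + w) = toReal z + toReal w := by ext; simp [toReal]
          rw [h, mulVec_add]
          exact add_nonneg (hz i) (hw i) }
    rintro _ ⟨n, hn, rfl⟩
    exact hgen T (fun n hn h1 h2 => ⟨pt n, hZ _ (Finset.mem_image_of_mem _
      (hG.mem_toFinset.2 ⟨hn, h1, h2⟩)), hpt0 n hn⟩) hn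

/-- if `S = s(M)` is a numerical semigroup with `gcd(S) = 1` for a full-rank
integer matrix `M ∈ ℤ^{k×k}`, then there is a real matrix `B₀` such that for every positive
integer `q`, every nonsingular integer matrix `B` with `‖B − q B₀‖_∞ < q/2` satisfies
`s(adj(B)) = S`. -/
theorem good_cube (k : ℕ) (hk : 0 < k) (M : Matrix (Fin k) (Fin k) ℤ)
    (hM : M.det ≠ 0)
    (S : Set ℕ) (hS : IsNumericalSemigroup S)
    (hgcd : ∀ e : ℕ, (∀ n ∈ S, e ∣ n) → e = 1)
    (hSM : {t : ℤ | ∃ z : Fin k → ℤ,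
        toReal z ∈ coneGen (fun i => toReal (fun r => M r i)) ∧ t = z ⟨0, hk⟩}
      = (fun n : ℕ => (n : ℤ)) '' S) :
    ∃ B₀ : Matrix (Fin k) (Fin k) ℝ, ∀ q : ℕ, 0 < q →
      ∀ B : Matrix (Fin k) (Fin k) ℤ, B.det ≠ 0 →
        (∀ i j, |(B i j : ℝ) - (q : ℝ) * B₀ i j| < (q : ℝ) / 2) →
        {t : ℤ | ∃ z : Fin k → ℤ,
            toReal z ∈ coneGen (fun i => toReal (fun r => B.adjugate r i)) ∧ t = z ⟨0, hk⟩}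
          = (fun n : ℕ => (n : ℤ)) '' S := by
  have h0 (i : Fin k) : 0 ≤ M ⟨0, hk⟩ i := by
    obtain ⟨n, -, hn⟩ := hSM.le ⟨fun r => M r i, mem_coneGen _ i, rfl⟩
    exact (Int.natCast_nonneg n).trans_eq hn
  obtain ⟨σ, hσ⟩ := exists_perm_det_pos hk M hM h0
  rw [← coneGen_comp_equiv _ σ] at hSM
  obtain ⟨N₀, hN₀⟩ := exists_eventually_proj_eq hk _ hσ S hS hgcd (fun i => h0 _) hSM
  obtain ⟨r, hr, hball⟩ := (Metric.eventually_nhds_iff (α := Fin k → Fin k → ℝ)).1 hN₀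
  refine ⟨(1 / (2 * r)) • N₀, fun q hq B _ hB => ?_⟩
  have hq' : (0 : ℝ) < q := by exact_mod_cast hq
  set c : ℝ := 2 * r / q with hc
  have hc0 : 0 < c := by positivity
  let N : Matrix (Fin k) (Fin k) ℝ := c • B.map Int.cast
  obtain ⟨hdet, hN⟩ := @hball N <| by
    refine (dist_pi_lt_iff hr).2 fun i => (dist_pi_lt_iff hr).2 fun j => ?_
    have h : N i j - N₀ i j = c * ((B i j : ℝ) - q * ((1 / (2 * r)) • N₀) i j) := by
      simp only [N, hc, Matrix.smul_apply, Matrix.map_apply, smul_eq_mul]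
      field_simp
    rw [Real.dist_eq, h, abs_mul, abs_of_pos hc0]
    calc c * _ < c * (q / 2) := mul_lt_mul_of_pos_left (hB i j) hc0
      _ = r := by rw [hc]; field_simp
  have hBdet : 0 < B.det := by
    have h : N.det = c ^ k * (B.det : ℝ) := by
      rw [Matrix.det_smul, Fintype.card_fin, Int.cast_det]
    rw [h] at hdet
    exact_mod_cast pos_of_mul_pos_right hdet (by positivity)
  rw [← hN]
  ext t
  refine exists_congr fun z => and_congr_left' ?_
  rw [toReal_mem_coneGen_iff_s19 hBdet (Matrix.adjugate_mul B) (Matrix.mul_adjugate B)]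
  refine forall_congr' fun i => ?_
  have h : (N.mulVec (toReal z)) i = c * ((B.mulVec z i : ℤ) : ℝ) := by
    simp [N, toReal, Matrix.mulVec, dotProduct, Finset.mul_sum, mul_assoc]
  rw [h, mul_nonneg_iff_of_pos_left hc0]
  exact Int.cast_nonneg_iff.symm
end
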